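/- arXiv:0905.1737 — 5 statements merged into one kernel-verified Lean document; each statement's English description precedes it below -/
import Mathlib

section
/- Let G be a finite connected simple graph on n vertices that admits a spanning tree T in which no vertex is saturated, i.e., every vertex of G is incident to at least one edge of G that is not an edge of T. Then there exist a port numbering π of G and a closed RH-walk with respect to π that visits every vertex of G and has length at most 2n. -/
/-- The degree of a vertex, as the cardinality of its neighbor set. -/
noncomputable def portDeg {V : Type*} (G : SimpleGraph V) (v : V) : ℕ :=
  (G.neighborSet v).ncard

/-- A port numbering assigns to each vertex `v` a bijection from its neighbors
onto `{1, …, deg v}`. -/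
def IsPortNumbering {V : Type*} (G : SimpleGraph V) (π : V → V → ℕ) : Prop :=
  ∀ v : V, Set.BijOn (π v) (G.neighborSet v) (Set.Icc 1 (portDeg G v))

/-- A closed right-hand walk of length `L ≥ 1` with respect to the port numbering `π`:
an `L`-periodic sequence of vertices, consecutive ones adjacent, such that the exit
port is always the cyclic successor of the entry port. -/
def IsClosedRHWalk {V : Type*} (G : SimpleGraph V) (π : V → V → ℕ) (L : ℕ) (w : ℕ → V) : Prop :=
  1 ≤ L ∧ (∀ i, w (i + L) = w i) ∧ (∀ i, G.Adj (w i) (w (i + 1))) ∧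
    (∀ i, π (w (i + 1)) (w (i + 2)) = π (w (i + 1)) (w i) % portDeg G (w (i + 1)) + 1)

/-- The walk visits every vertex within one period. -/
def VisitsAll {V : Type*} (L : ℕ) (w : ℕ → V) : Prop :=
  ∀ v : V, ∃ i < L, w i = v

/-- `c` may follow `d` in a tour with ranks `r`: it starts where `d` ends, and at that vertex
the rank strictly increases from the entry neighbor to the exit neighbor. -/
def TourStep {V : Type*} (r : V → V → ℤ) (d c : V × V) : Prop :=
  d.2 = c.1 ∧ r d.2 d.1 < r d.2 c.2

/-- A cyclic sequence of distinct darts of `G`, consecutive ones composable, together with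
ranks certifying that no set of transitions at a vertex closes up. -/
structure IsTour {V : Type*} (G : SimpleGraph V) (D : List (V × V)) (r : V → V → ℤ) : Prop where
  nodup : D.Nodup
  adj : ∀ d ∈ D, G.Adj d.1 d.2
  chain : (D : Cycle (V × V)).Chain (TourStep r)

theorem IsTour.of_isRotated {V : Type*} {G : SimpleGraph V} {D D' : List (V × V)}
    {r : V → V → ℤ} (h : IsTour G D r) (hD : D ~r D') : IsTour G D' r := by
  refine ⟨hD.nodup_iff.1 h.nodup, fun d hd => h.adj d (hD.mem_iff.2 hd), ?_⟩
  rw [← Cycle.coe_eq_coe.2 hD]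
  exact h.chain

theorem IsTour.exists_isRotated {V : Type*} {G : SimpleGraph V} {D : List (V × V)}
    {r : V → V → ℤ} (h : IsTour G D r) {o : V × V} (ho : o ∈ D) :
    ∃ e t, IsTour G (e :: o :: t) r ∧ (e :: o :: t).Perm D := by
  obtain ⟨a, b, rfl⟩ := List.append_of_mem ho
  have hrot : (a ++ o :: b) ~r (o :: (b ++ a)) := List.isRotated_append
  rcases List.eq_nil_or_concat (b ++ a) with hnil | ⟨l, e, hl⟩
  · rw [hnil] at hrot
    have h' := (h.of_isRotated hrot)
    have hc := h'.chain
    rw [Cycle.chain_singleton] at hc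
    exact absurd hc.1 (h'.adj o (by simp)).ne'
  · rw [hl] at hrot
    have hrot' : (a ++ o :: b) ~r (e :: o :: l) := by
      rw [List.concat_eq_append] at hrot
      exact hrot.trans (List.isRotated_append (l := o :: l) (l' := [e]))
    exact ⟨e, l, h.of_isRotated hrot', hrot'.perm.symm⟩

theorem isTour_cons_cons_iff {V : Type*} {G : SimpleGraph V} {e o : V × V} {t : List (V × V)}
    {r : V → V → ℤ} :
    IsTour G (e :: o :: t) r ↔ (e :: o :: t).Nodup ∧ (∀ d ∈ e :: o :: t, G.Adj d.1 d.2) ∧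
      TourStep r e o ∧ List.IsChain (TourStep r) (o :: (t ++ [e])) := by
  constructor
  · intro h
    have := h.chain
    rw [Cycle.chain_coe_cons, List.cons_append, List.isChain_cons_cons] at this
    exact ⟨h.nodup, h.adj, this⟩
  · rintro ⟨h1, h2, h3⟩
    refine ⟨h1, h2, ?_⟩
    rwa [Cycle.chain_coe_cons, List.cons_append, List.isChain_cons_cons]

/-- Two tours without a common edge that meet at a vertex can be spliced. -/
theorem IsTour.splice {V : Type*} {G : SimpleGraph V} {D₁ D₂ : List (V × V)}
    {r₁ r₂ : V → V → ℤ} (h₁ : IsTour G D₁ r₁) (h₂ : IsTour G D₂ r₂)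
    (hdisj : ∀ d ∈ D₁, d ∉ D₂ ∧ d.swap ∉ D₂) {o₁ o₂ : V × V} (ho₁ : o₁ ∈ D₁) (ho₂ : o₂ ∈ D₂)
    (ho : o₁.1 = o₂.1) : ∃ D r, IsTour G D r ∧ D.Perm (D₁ ++ D₂) := by
  classical
  obtain ⟨e₁, t₁, h₁, hp₁⟩ := h₁.exists_isRotated ho₁
  obtain ⟨e₂, t₂, h₂, hp₂⟩ := h₂.exists_isRotated ho₂
  have hp : (e₁ :: o₂ :: (t₂ ++ e₂ :: o₁ :: t₁)).Perm (D₁ ++ D₂) := by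
    refine List.Perm.trans ?_ (hp₁.append hp₂)
    grind
  obtain ⟨hn₁, ha₁, hs₁, hc₁⟩ := isTour_cons_cons_iff.1 h₁
  obtain ⟨hn₂, ha₂, hs₂, hc₂⟩ := isTour_cons_cons_iff.1 h₂
  have hm₁ : ∀ d, d ∈ D₁ ↔ d ∈ e₁ :: o₁ :: t₁ := fun d => hp₁.mem_iff.symm
  have hm₂ : ∀ d, d ∈ D₂ ↔ d ∈ e₂ :: o₂ :: t₂ := fun d => hp₂.mem_iff.symm
  set r : V → V → ℤ := fun z x =>
    if (z, x) ∈ D₁ ∨ (x, z) ∈ D₁ then r₁ z x - r₁ e₁.2 e₁.1 else r₂ z x - r₂ e₂.2 e₂.1 with hr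
  have hr₁ : ∀ d ∈ D₁, r d.1 d.2 = r₁ d.1 d.2 - r₁ e₁.2 e₁.1 ∧
      r d.2 d.1 = r₁ d.2 d.1 - r₁ e₁.2 e₁.1 := by
    intro d hd
    simp [hr, hd]
  have hr₂ : ∀ d ∈ D₂, r d.1 d.2 = r₂ d.1 d.2 - r₂ e₂.2 e₂.1 ∧
      r d.2 d.1 = r₂ d.2 d.1 - r₂ e₂.2 e₂.1 := by
    intro d hd
    have h1 : (d.1, d.2) ∉ D₁ := fun h => (hdisj _ h).1 hd
    have h2 : (d.2, d.1) ∉ D₁ := fun h => (hdisj _ h).2 hd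
    simp [hr, h1, h2]
  have hstep₁ : ∀ d ∈ D₁, ∀ d' ∈ D₁, TourStep r₁ d d' → TourStep r d d' := by
    rintro d hd d' hd' ⟨h1, h2⟩
    refine ⟨h1, ?_⟩
    rw [(hr₁ d hd).2]
    rw [h1] at h2 ⊢
    rw [(hr₁ d' hd').1]
    omega
  have hstep₂ : ∀ d ∈ D₂, ∀ d' ∈ D₂, TourStep r₂ d d' → TourStep r d d' := by
    rintro d hd d' hd' ⟨h1, h2⟩
    refine ⟨h1, ?_⟩
    rw [(hr₂ d hd).2]
    rw [h1] at h2 ⊢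
    rw [(hr₂ d' hd').1]
    omega
  have hmem₁ : ∀ d ∈ o₁ :: (t₁ ++ [e₁]), d ∈ D₁ := by
    intro d hd
    rw [hm₁]
    simp only [List.mem_cons, List.mem_append, List.not_mem_nil, or_false] at hd ⊢
    tauto
  have he₁ : e₁ ∈ D₁ := by simp [hm₁]
  have hmem₂ : ∀ d ∈ o₂ :: (t₂ ++ [e₂]), d ∈ D₂ := by
    intro d hd
    rw [hm₂]
    simp only [List.mem_cons, List.mem_append, List.not_mem_nil, or_false] at hd ⊢
    tauto
  have he₂ : e₂ ∈ D₂ := by simp [hm₂]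
  refine ⟨_, r, isTour_cons_cons_iff.2 ⟨?_, ?_, ?_, ?_⟩, hp⟩
  · rw [hp.nodup_iff, List.nodup_append']
    refine ⟨hp₁.nodup_iff.1 hn₁, hp₂.nodup_iff.1 hn₂, fun d hd => (hdisj d hd).1⟩
  · intro d hd
    rw [hp.mem_iff, List.mem_append] at hd
    grind
  · refine ⟨by rw [hs₁.1, ho], ?_⟩
    have := hs₂.2
    rw [(hr₁ e₁ he₁).2, hs₁.1, ho, (hr₂ o₂ ho₂).1]
    rw [hs₂.1] at this ⊢
    omega
  · have hl : o₂ :: (t₂ ++ e₂ :: o₁ :: t₁ ++ [e₁]) =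
        (o₂ :: t₂) ++ e₂ :: o₁ :: (t₁ ++ [e₁]) := by simp
    rw [hl, List.isChain_split, List.cons_append, List.isChain_cons_cons]
    refine ⟨hc₂.imp_of_mem_imp fun a b ha hb => hstep₂ a (hmem₂ a ha) b (hmem₂ b hb), ?_,
      hc₁.imp_of_mem_imp fun a b ha hb => hstep₁ a (hmem₁ a ha) b (hmem₁ b hb)⟩
    · refine ⟨by rw [hs₂.1, ho], ?_⟩
      have := hs₁.2
      rw [(hr₂ e₂ he₂).2, hs₂.1, ← ho, (hr₁ o₁ ho₁).1]
      rw [hs₁.1] at this ⊢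
      omega

/-- Two tours without a common edge can be joined by traversing an unused edge between them
in both directions. -/
theorem IsTour.bridge {V : Type*} {G : SimpleGraph V} {D₁ D₂ : List (V × V)}
    {r₁ r₂ : V → V → ℤ} (h₁ : IsTour G D₁ r₁) (h₂ : IsTour G D₂ r₂)
    (hdisj : ∀ d ∈ D₁, d ∉ D₂ ∧ d.swap ∉ D₂) {o₁ o₂ : V × V} (ho₁ : o₁ ∈ D₁) (ho₂ : o₂ ∈ D₂)
    (hadj : G.Adj o₁.1 o₂.1) (hb₁ : ∀ d ∈ D₁, s(d.1, d.2) ≠ s(o₁.1, o₂.1))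
    (hb₂ : ∀ d ∈ D₂, s(d.1, d.2) ≠ s(o₁.1, o₂.1)) :
    ∃ D r, IsTour G D r ∧ D.Perm ((o₁.1, o₂.1) :: (o₂.1, o₁.1) :: (D₁ ++ D₂)) := by
  classical
  obtain ⟨e₁, t₁, h₁, hp₁⟩ := h₁.exists_isRotated ho₁
  obtain ⟨e₂, t₂, h₂, hp₂⟩ := h₂.exists_isRotated ho₂
  set u := o₁.1 with hu
  set v := o₂.1 with hv
  have hp : (e₁ :: (u, v) :: (o₂ :: (t₂ ++ e₂ :: (v, u) :: o₁ :: t₁))).Perm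
      ((u, v) :: (v, u) :: (D₁ ++ D₂)) := by
    refine List.Perm.trans ?_ (((hp₁.append hp₂).cons _).cons _)
    grind
  obtain ⟨hn₁, ha₁, hs₁, hc₁⟩ := isTour_cons_cons_iff.1 h₁
  obtain ⟨hn₂, ha₂, hs₂, hc₂⟩ := isTour_cons_cons_iff.1 h₂
  have hm₁ : ∀ d, d ∈ D₁ ↔ d ∈ e₁ :: o₁ :: t₁ := fun d => hp₁.mem_iff.symm
  have hm₂ : ∀ d, d ∈ D₂ ↔ d ∈ e₂ :: o₂ :: t₂ := fun d => hp₂.mem_iff.symm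
  set r : V → V → ℤ := fun z x =>
    if z = u ∧ x = v then 2 * r₁ u e₁.1 + 1 else
    if z = v ∧ x = u then 2 * r₂ v e₂.1 + 1 else
    if (z, x) ∈ D₁ ∨ (x, z) ∈ D₁ then 2 * r₁ z x else 2 * r₂ z x with hr
  have hruv : r u v = 2 * r₁ u e₁.1 + 1 := by simp [hr]
  have hrvu : r v u = 2 * r₂ v e₂.1 + 1 := by simp [hr, hadj.ne, hadj.ne']
  have hr₁ : ∀ d ∈ D₁, r d.1 d.2 = 2 * r₁ d.1 d.2 ∧ r d.2 d.1 = 2 * r₁ d.2 d.1 := by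
    intro d hd
    have h1 : ¬ (d.1 = u ∧ d.2 = v) := by rintro ⟨h, h'⟩; exact hb₁ d hd (by rw [h, h'])
    have h2 : ¬ (d.1 = v ∧ d.2 = u) := by
      rintro ⟨h, h'⟩; exact hb₁ d hd (by rw [h, h', Sym2.eq_swap])
    have h3 : ¬ (d.2 = u ∧ d.1 = v) := fun h => h2 h.symm
    have h4 : ¬ (d.2 = v ∧ d.1 = u) := fun h => h1 h.symm
    simp only [hr, if_neg h1, if_neg h2, if_neg h3, if_neg h4]
    simp [hd]
  have hr₂ : ∀ d ∈ D₂, r d.1 d.2 = 2 * r₂ d.1 d.2 ∧ r d.2 d.1 = 2 * r₂ d.2 d.1 := by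
    intro d hd
    have h1 : ¬ (d.1 = u ∧ d.2 = v) := by rintro ⟨h, h'⟩; exact hb₂ d hd (by rw [h, h'])
    have h2 : ¬ (d.1 = v ∧ d.2 = u) := by
      rintro ⟨h, h'⟩; exact hb₂ d hd (by rw [h, h', Sym2.eq_swap])
    have h3 : ¬ (d.2 = u ∧ d.1 = v) := fun h => h2 h.symm
    have h4 : ¬ (d.2 = v ∧ d.1 = u) := fun h => h1 h.symm
    have h5 : (d.1, d.2) ∉ D₁ := fun h => (hdisj _ h).1 hd
    have h6 : (d.2, d.1) ∉ D₁ := fun h => (hdisj _ h).2 hd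
    simp only [hr, if_neg h1, if_neg h2, if_neg h3, if_neg h4]
    simp [h5, h6]
  have hstep₁ : ∀ d ∈ D₁, ∀ d' ∈ D₁, TourStep r₁ d d' → TourStep r d d' := by
    rintro d hd d' hd' ⟨h1, h2⟩
    refine ⟨h1, ?_⟩
    rw [(hr₁ d hd).2]
    rw [h1] at h2 ⊢
    rw [(hr₁ d' hd').1]
    omega
  have hstep₂ : ∀ d ∈ D₂, ∀ d' ∈ D₂, TourStep r₂ d d' → TourStep r d d' := by
    rintro d hd d' hd' ⟨h1, h2⟩
    refine ⟨h1, ?_⟩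
    rw [(hr₂ d hd).2]
    rw [h1] at h2 ⊢
    rw [(hr₂ d' hd').1]
    omega
  have hmem₁ : ∀ d ∈ o₁ :: (t₁ ++ [e₁]), d ∈ D₁ := by
    intro d hd
    rw [hm₁]
    simp only [List.mem_cons, List.mem_append, List.not_mem_nil, or_false] at hd ⊢
    tauto
  have he₁ : e₁ ∈ D₁ := by simp [hm₁]
  have hmem₂ : ∀ d ∈ o₂ :: (t₂ ++ [e₂]), d ∈ D₂ := by
    intro d hd
    rw [hm₂]
    simp only [List.mem_cons, List.mem_append, List.not_mem_nil, or_false] at hd ⊢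
    tauto
  have he₂ : e₂ ∈ D₂ := by simp [hm₂]
  have hs₁' := hs₁.2
  have hs₂' := hs₂.2
  have hre₁ := (hr₁ e₁ he₁).2
  have hre₂ := (hr₂ e₂ he₂).2
  have hro₁ := (hr₁ o₁ ho₁).1
  have hro₂ := (hr₂ o₂ ho₂).1
  rw [hs₁.1, ← hu] at hs₁' hre₁
  rw [hs₂.1, ← hv] at hs₂' hre₂
  rw [← hu] at hro₁
  rw [← hv] at hro₂
  refine ⟨_, r, isTour_cons_cons_iff.2 ⟨?_, ?_, ?_, ?_⟩, hp⟩
  · rw [hp.nodup_iff, List.nodup_cons, List.nodup_cons, List.nodup_append']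
    refine ⟨?_, ?_, hp₁.nodup_iff.1 hn₁, hp₂.nodup_iff.1 hn₂, fun d hd => (hdisj d hd).1⟩
    · simp only [List.mem_cons, List.mem_append, Prod.mk.injEq, not_or]
      exact ⟨fun h => hadj.ne h.1, fun h => hb₁ _ h rfl, fun h => hb₂ _ h rfl⟩
    · simp only [List.mem_append, not_or]
      exact ⟨fun h => hb₁ _ h Sym2.eq_swap, fun h => hb₂ _ h Sym2.eq_swap⟩
  · intro d hd
    rw [hp.mem_iff, List.mem_cons, List.mem_cons, List.mem_append] at hd
    rcases hd with rfl | rfl | hd | hd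
    · exact hadj
    · exact hadj.symm
    · exact ha₁ d (by rwa [← hm₁])
    · exact ha₂ d (by rwa [← hm₂])
  · refine ⟨hs₁.1, ?_⟩
    rw [hs₁.1, ← hu]
    simp only
    omega
  · have hl : (u, v) :: (o₂ :: (t₂ ++ e₂ :: (v, u) :: o₁ :: t₁) ++ [e₁]) =
        (u, v) :: ((o₂ :: t₂) ++ e₂ :: (v, u) :: o₁ :: (t₁ ++ [e₁])) := by simp
    rw [hl, List.cons_append, List.isChain_cons_cons, ← List.cons_append, List.isChain_split,
      List.cons_append, List.isChain_cons_cons, List.isChain_cons_cons]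
    refine ⟨⟨hv, ?_⟩,
      hc₂.imp_of_mem_imp fun a b ha hb => hstep₂ a (hmem₂ a ha) b (hmem₂ b hb),
      ⟨hs₂.1, ?_⟩, ⟨hu, ?_⟩,
      hc₁.imp_of_mem_imp fun a b ha hb => hstep₁ a (hmem₁ a ha) b (hmem₁ b hb)⟩
    · simp only
      omega
    · rw [hs₂.1, ← hv]
      simp only
      omega
    · simp only
      omega

/-- A partial matching of a finite set along which some rank strictly increases extends to a
linear order of that set, numbered from `1`, in which matched elements are consecutive. -/
theorem exists_bijOn_Icc_of_rank {V : Type*} (N : Finset V) (R : V → V → Prop) (r : V → ℤ)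
    (hr : ∀ x y, R x y → r x < r y) (hfun : ∀ x y y', R x y → R x y' → y = y')
    (hinj : ∀ x x' y, R x y → R x' y → x = x') :
    ∃ π : V → ℕ, Set.BijOn π N (Set.Icc 1 N.card) ∧
      ∀ x ∈ N, ∀ y ∈ N, R x y → π y = π x + 1 := by
  classical
  induction N using Finset.induction_on_max_value r with
  | empty => exact ⟨fun _ => 0, by simp, by simp⟩
  | insert a s ha hmax ih =>
    obtain ⟨π, hπ, hR⟩ := ih
    have hpos : ∀ x ∈ s, 1 ≤ π x ∧ π x ≤ s.card := fun x hx => hπ.mapsTo hx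
    obtain ⟨k, hk, hkR⟩ : ∃ k ≤ s.card, ∀ x ∈ s, R x a ↔ π x = k := by
      by_cases h : ∃ x ∈ s, R x a
      · obtain ⟨x, hx, hxa⟩ := h
        exact ⟨π x, (hpos x hx).2, fun y hy => ⟨fun hya => by rw [hinj _ _ _ hya hxa],
          fun hyx => by rwa [hπ.injOn hy hx hyx]⟩⟩
      · push Not at h
        exact ⟨0, Nat.zero_le _, fun x hx => ⟨fun hxa => absurd hxa (h x hx),
          fun hx0 => by have := (hpos x hx).1; omega⟩⟩
    set π' : V → ℕ := fun z => if z = a then k + 1 else if π z ≤ k then π z else π z + 1 with hπ'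
    have hπa : π' a = k + 1 := by simp [hπ']
    have hπs : ∀ x ∈ s, π' x = if π x ≤ k then π x else π x + 1 := by
      intro x hx
      have : x ≠ a := fun h => ha (h ▸ hx)
      simp [hπ', this]
    refine ⟨π', ⟨?_, ?_, ?_⟩, ?_⟩
    · intro x hx
      rw [Finset.card_insert_of_notMem ha, Set.mem_Icc]
      rcases Finset.mem_insert.1 hx with rfl | hx
      · omega
      · have := hpos x hx
        rw [hπs x hx]
        split_ifs <;> omega
    · intro x hx y hy hxy
      rcases Finset.mem_insert.1 hx with rfl | hxs <;>
        rcases Finset.mem_insert.1 hy with rfl | hys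
      · rfl
      · rw [hπa, hπs y hys] at hxy
        split_ifs at hxy <;> omega
      · rw [hπa, hπs x hxs] at hxy
        split_ifs at hxy <;> omega
      · rw [hπs x hxs, hπs y hys] at hxy
        apply hπ.injOn hxs hys
        split_ifs at hxy <;> omega
    · intro m hm
      rw [Finset.card_insert_of_notMem ha, Set.mem_Icc] at hm
      rcases lt_trichotomy m (k + 1) with h | h | h
      · obtain ⟨x, hx, hxm⟩ := hπ.surjOn (show m ∈ Set.Icc 1 s.card from ⟨by omega, by omega⟩)
        refine ⟨x, Finset.mem_insert_of_mem hx, ?_⟩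
        rw [hπs x hx, if_pos (by omega), hxm]
      · exact ⟨a, Finset.mem_insert_self _ _, by rw [hπa, h]⟩
      · obtain ⟨x, hx, hxm⟩ :=
          hπ.surjOn (show m - 1 ∈ Set.Icc 1 s.card from ⟨by omega, by omega⟩)
        refine ⟨x, Finset.mem_insert_of_mem hx, ?_⟩
        rw [hπs x hx, if_neg (by omega), hxm]
        omega
    · intro x hx y hy hxy
      have hlt := hr x y hxy
      rcases Finset.mem_insert.1 hx with rfl | hxs <;>
        rcases Finset.mem_insert.1 hy with rfl | hys
      · omega
      · have := hmax y hys
        omega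
      · rw [hπa, hπs x hxs, (hkR x hxs).1 hxy, if_pos le_rfl]
      · have h1 := hR x hxs y hys hxy
        have h2 : π x ≠ k := fun hxk => ha (hfun x y a hxy ((hkR x hxs).2 hxk) ▸ hys)
        rw [hπs x hxs, hπs y hys]
        split_ifs <;> omega

theorem List.cyclic_getElem_of_chain {α : Type*} {R : α → α → Prop} {l : List α} (hl : l ≠ [])
    (h : (l : Cycle α).Chain R) (i : ℕ) :
    R (l[i % l.length]'(Nat.mod_lt _ (List.length_pos_iff.2 hl)))
      (l[(i + 1) % l.length]'(Nat.mod_lt _ (List.length_pos_iff.2 hl))) := by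
  obtain ⟨a, t, rfl⟩ := List.exists_cons_of_ne_nil hl
  rw [Cycle.chain_coe_cons, List.isChain_iff_getElem] at h
  have hlt : i % (a :: t).length < (a :: t).length := Nat.mod_lt _ (by simp)
  have := h (i % (a :: t).length) (by simpa using hlt)
  simp only [← List.cons_append] at this
  rw [List.getElem_append_left hlt] at this
  rcases Nat.lt_or_ge (i % (a :: t).length + 1) (a :: t).length with h1 | h1
  · rw [List.getElem_append_left h1] at this
    convert this using 2
    rw [← Nat.mod_add_mod, Nat.mod_eq_of_lt h1]
  · have h2 : i % (a :: t).length + 1 = (a :: t).length := by omega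
    rw [List.getElem_append_right h1] at this
    have h3 : (i + 1) % (a :: t).length = 0 := by rw [← Nat.mod_add_mod, h2, Nat.mod_self]
    simp only [h3]
    simpa using this

/-- A tour is the trajectory of a closed right-hand walk for a suitable port numbering. -/
theorem IsTour.exists_isClosedRHWalk {V : Type*} [Finite V] {G : SimpleGraph V}
    {D : List (V × V)} {r : V → V → ℤ} (h : IsTour G D r) (hD : D ≠ []) :
    ∃ π : V → V → ℕ, IsPortNumbering G π ∧ ∃ w : ℕ → V, IsClosedRHWalk G π D.length w ∧
      ∀ d ∈ D, ∃ i < D.length, w i = d.1 := by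
  have hpos : 0 < D.length := List.length_pos_iff.2 hD
  set f : ℕ → V × V := fun i => D[i % D.length]'(Nat.mod_lt _ hpos) with hf
  have hstep : ∀ i, TourStep r (f i) (f (i + 1)) := List.cyclic_getElem_of_chain hD h.chain
  have hmem : ∀ i, f i ∈ D := fun i => List.getElem_mem _
  have hinj : ∀ i j, f i = f j → i % D.length = j % D.length := fun i j hij =>
    (h.nodup.getElem_inj_iff).1 hij
  have hcongr : ∀ i j, i % D.length = j % D.length → f i = f j := fun i j hij => by
    simp only [hf, hij]
  have hloc : ∀ v : V, ∃ p : V → ℕ, Set.BijOn p (G.neighborSet v) (Set.Icc 1 (portDeg G v)) ∧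
      ∀ i, (f i).2 = v → p (f (i + 1)).2 = p (f i).1 + 1 := by
    intro v
    have hfin := (G.neighborSet v).toFinite
    have hr : ∀ x y, (∃ i, f i = (x, v) ∧ f (i + 1) = (v, y)) → r v x < r v y := by
      rintro x y ⟨i, hx, hy⟩
      simpa [hx, hy] using (hstep i).2
    have hfun : ∀ x y y', (∃ i, f i = (x, v) ∧ f (i + 1) = (v, y)) →
        (∃ i, f i = (x, v) ∧ f (i + 1) = (v, y')) → y = y' := by
      rintro x y y' ⟨i, hx, hy⟩ ⟨j, hx', hy'⟩
      have := hcongr (i + 1) (j + 1) (Nat.ModEq.add_right 1 (hinj i j (hx.trans hx'.symm)))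
      rw [hy, hy'] at this
      exact congrArg Prod.snd this
    have hinj' : ∀ x x' y, (∃ i, f i = (x, v) ∧ f (i + 1) = (v, y)) →
        (∃ i, f i = (x', v) ∧ f (i + 1) = (v, y)) → x = x' := by
      rintro x x' y ⟨i, hx, hy⟩ ⟨j, hx', hy'⟩
      have := hcongr i j (Nat.ModEq.add_right_cancel' 1 (hinj _ _ (hy.trans hy'.symm)))
      rw [hx, hx'] at this
      exact congrArg Prod.fst this
    obtain ⟨p, hp, hpR⟩ := exists_bijOn_Icc_of_rank hfin.toFinset
      (fun x y => ∃ i, f i = (x, v) ∧ f (i + 1) = (v, y)) (r v) hr hfun hinj'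
    · rw [← Set.ncard_eq_toFinset_card, hfin.coe_toFinset] at hp
      refine ⟨p, hp, fun i hi => hpR _ ?_ _ ?_ ⟨i, ?_, ?_⟩⟩
      · simpa [← hi] using (h.adj _ (hmem i)).symm
      · simpa [← hi, (hstep i).1] using h.adj _ (hmem (i + 1))
      · rw [← hi]
      · rw [← hi, (hstep i).1]
  choose π hπ hπf using hloc
  refine ⟨π, hπ, fun i => (f i).1, ⟨hpos, ?_, ?_, ?_⟩, ?_⟩
  · intro i
    simp [hf]
  · intro i
    show G.Adj (f i).1 (f (i + 1)).1
    rw [← (hstep i).1]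
    exact h.adj _ (hmem i)
  · intro i
    show π (f (i + 1)).1 (f (i + 2)).1 = π (f (i + 1)).1 (f i).1 % portDeg G (f (i + 1)).1 + 1
    have h1 : π (f (i + 1)).1 (f (i + 2)).1 = π (f (i + 1)).1 (f i).1 + 1 := by
      rw [← hπf (f (i + 1)).1 i (hstep i).1, (hstep (i + 1)).1]
    have h2 : π (f (i + 1)).1 (f (i + 2)).1 ≤ portDeg G (f (i + 1)).1 := by
      refine ((hπ (f (i + 1)).1).mapsTo ?_).2
      rw [← (hstep (i + 1)).1]
      exact h.adj _ (hmem (i + 1))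
    rw [Nat.mod_eq_of_lt (by omega)]
    exact h1
  · intro d hd
    obtain ⟨i, hi, rfl⟩ := List.getElem_of_mem hd
    exact ⟨i, hi, by simp [hf, Nat.mod_eq_of_lt hi]⟩

theorem IsTour.exists_fst_eq_snd {V : Type*} {G : SimpleGraph V} {D : List (V × V)}
    {r : V → V → ℤ} (h : IsTour G D r) {d : V × V} (hd : d ∈ D) : ∃ d' ∈ D, d'.1 = d.2 := by
  obtain ⟨i, hi, rfl⟩ := List.getElem_of_mem hd
  have := List.cyclic_getElem_of_chain (List.ne_nil_of_mem hd) h.chain i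
  simp only [Nat.mod_eq_of_lt hi] at this
  exact ⟨_, List.getElem_mem _, this.1.symm⟩

/-- Every closed trail is a tour. -/
theorem SimpleGraph.Walk.IsTrail.exists_isTour {V : Type*} {G H : SimpleGraph V} (hHG : H ≤ G)
    {w : V} {p : H.Walk w w} (hp : p.IsTrail) :
    ∃ r, IsTour G (p.darts.map fun d => d.toProd) r := by
  classical
  have hnd : (p.darts.map SimpleGraph.Dart.edge).Nodup := hp.edges_nodup
  have hsymm : ∀ d ∈ p.darts, ∀ d' ∈ p.darts, d'.toProd ≠ d.toProd.swap := by
    intro d hd d' hd' h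
    have h1 : d'.edge = d.edge := by
      rw [SimpleGraph.dart_edge_eq_iff]
      exact Or.inr (SimpleGraph.Dart.ext _ _ h)
    have h2 : d' = d := List.inj_on_of_nodup_map hnd hd' hd h1
    rw [h2] at h
    exact d.adj.ne (congrArg Prod.fst h)
  set D := p.darts.map fun d => d.toProd with hD
  set r : V → V → ℤ := fun z x => if (z, x) ∈ D then 1 else 0 with hr
  have hstep : ∀ d ∈ p.darts, ∀ d' ∈ p.darts, H.DartAdj d d' → TourStep r d.toProd d'.toProd := by
    intro d hd d' hd' hdd
    refine ⟨hdd, ?_⟩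
    have h1 : (d.snd, d.fst) ∉ D := by
      intro hmem
      obtain ⟨c, hc, hcd⟩ := List.mem_map.1 hmem
      exact hsymm d hd c hc hcd
    have h2 : (d.snd, d'.snd) ∈ D := by
      rw [show d.snd = d'.fst from hdd]
      exact List.mem_map_of_mem hd'
    simp [hr, h1, h2]
  refine ⟨r, ?_, ?_, ?_⟩
  · exact (List.Nodup.of_map _ hnd).map SimpleGraph.Dart.toProd_injective
  · intro d hd
    obtain ⟨c, -, rfl⟩ := List.mem_map.1 hd
    exact hHG c.adj
  · cases p with
    | nil => simp [hD]
    | cons h q =>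
      have hc := ((SimpleGraph.Walk.cons h q).append (.cons h .nil)).isChain_dartAdj_darts
      simp only [SimpleGraph.Walk.cons_append, SimpleGraph.Walk.darts_cons,
        SimpleGraph.Walk.darts_append, SimpleGraph.Walk.darts_nil] at hc hD hstep
      rw [hD, List.map_cons, Cycle.chain_coe_cons]
      have := List.isChain_map_of_isChain (S := TourStep r)
        (fun d : H.Dart => d.toProd) (R := fun a b => TourStep r a.toProd b.toProd)
        (fun _ _ h => h)
        (hc.imp_of_mem_imp fun a b ha hb => hstep a (by grind) b (by grind))
      simpa using this

/-- In a finite graph all of whose degrees are even, every edge lies on a cycle. -/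
theorem SimpleGraph.exists_isCycle_of_even_degree {V : Type*} [Fintype V] {H : SimpleGraph V}
    [DecidableRel H.Adj] (heven : ∀ v, Even (H.degree v)) {u v : V} (huv : H.Adj u v) :
    ∃ (w : V) (p : H.Walk w w), p.IsCycle ∧ s(u, v) ∈ p.edges := by
  classical
  rw [← SimpleGraph.adj_and_reachable_delete_edges_iff_exists_cycle]
  refine ⟨huv, ?_⟩
  set K := H.deleteEdges {s(u, v)} with hK
  have hdeg : ∀ x, K.degree x + (if x ∈ s(u, v) then 1 else 0) = H.degree x := by
    intro x
    rw [← card_incidenceFinset_eq_degree, ← card_incidenceFinset_eq_degree,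
      incidenceFinset_eq_filter, incidenceFinset_eq_filter]
    have hKe : K.edgeFinset = H.edgeFinset.erase s(u, v) := by
      ext e
      simp [hK, and_comm]
    have hmem : s(u, v) ∈ H.edgeFinset := by simpa using huv
    rw [hKe, Finset.filter_erase]
    split_ifs with hx
    · exact Finset.card_erase_add_one (by simpa [huv] using hx)
    · rw [Finset.erase_eq_of_notMem (by simpa using fun _ => hx), add_zero]
  set S : Set V := {x | K.Reachable u x} with hS
  have hnb : ∀ x : S, K.neighborSet x ⊆ S := fun x y hy =>
    SimpleGraph.Reachable.trans x.2 (SimpleGraph.Adj.reachable hy)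
  have hdegS : ∀ x : S, (K.induce S).degree x = K.degree x := fun x => by
    convert degree_induce_of_neighborSet_subset (hnb x)
  obtain ⟨⟨w, hw⟩, hwu, hodd⟩ := (K.induce S).exists_ne_odd_degree_of_exists_odd_degree
    ⟨u, SimpleGraph.Reachable.refl u⟩ (by
      rw [hdegS]
      have h1 := hdeg u
      have h2 := heven u
      rw [if_pos (by simp)] at h1
      rw [← h1, Nat.even_add_one, Nat.not_even_iff_odd] at h2
      exact h2)
  rw [hdegS] at hodd
  have h1 := hdeg w
  by_cases hwe : w ∈ s(u, v)
  · rcases Sym2.mem_iff.1 hwe with rfl | rfl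
    · exact absurd rfl hwu
    · exact hw
  · rw [if_neg hwe, add_zero] at h1
    exact absurd (heven w) (Nat.not_even_iff_odd.2 (h1 ▸ hodd))

theorem SimpleGraph.Walk.IsTrail.even_card_filter_edges_iff {V : Type*} [DecidableEq V]
    {G : SimpleGraph V} {u v : V} {p : G.Walk u v} (hp : p.IsTrail) (x : V) :
    Even (p.edges.toFinset.filter (x ∈ ·)).card ↔ u ≠ v → x ≠ u ∧ x ≠ v := by
  rw [← hp.even_countP_edges_iff x, List.countP_eq_length_filter,
    ← List.toFinset_card_of_nodup (hp.edges_nodup.filter _), List.toFinset_filter]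
  simp

/-- Every vertex lies on an even number of the given edges. -/
def EvenIncidence {V : Type*} [DecidableEq V] (R : Finset (Sym2 V)) : Prop :=
  ∀ v, Even (R.filter (v ∈ ·)).card

theorem EvenIncidence.exists_isTour {V : Type*} [Fintype V] [DecidableEq V] {G : SimpleGraph V}
    {R : Finset (Sym2 V)} (hR : EvenIncidence R) (hRG : ∀ e ∈ R, e ∈ G.edgeSet) {e : Sym2 V}
    (he : e ∈ R) :
    ∃ (D : List (V × V)) (r : V → V → ℤ) (Z : Finset (Sym2 V)), IsTour G D r ∧ Z ⊆ R ∧ e ∈ Z ∧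
      (∀ d ∈ D, s(d.1, d.2) ∈ Z) ∧ (∀ f ∈ Z, ∀ x ∈ f, ∃ d ∈ D, d.1 = x) ∧
      D.length = Z.card ∧ EvenIncidence (R \ Z) := by
  classical
  set H : SimpleGraph V := SimpleGraph.fromEdgeSet (R : Set (Sym2 V)) with hH
  have hHR : ∀ f, f ∈ H.edgeSet ↔ f ∈ R := by
    intro f
    simp only [hH, SimpleGraph.edgeSet_fromEdgeSet, Set.mem_sdiff, Finset.mem_coe]
    exact ⟨fun h => h.1, fun h => ⟨h, G.not_isDiag_of_mem_edgeSet (hRG f h)⟩⟩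
  have hHG : H ≤ G := by
    rw [← SimpleGraph.edgeSet_subset_edgeSet]
    exact fun f hf => hRG f ((hHR f).1 hf)
  have heven : ∀ v, Even (H.degree v) := by
    intro v
    rw [← SimpleGraph.card_incidenceFinset_eq_degree, SimpleGraph.incidenceFinset_eq_filter]
    convert hR v using 3
    ext f
    simp [hHR]
  induction e using Sym2.ind with | _ a b
  obtain ⟨w, p, hp, hpe⟩ := SimpleGraph.exists_isCycle_of_even_degree heven ((hHR _).2 he)
  have htr := hp.isTrail
  obtain ⟨r, hr⟩ := htr.exists_isTour hHG
  have hmem : ∀ d ∈ p.darts.map (fun d => d.toProd), s(d.1, d.2) ∈ p.edges := by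
    intro d hd
    obtain ⟨c, hc, rfl⟩ := List.mem_map.1 hd
    exact List.mem_map_of_mem hc
  refine ⟨_, r, p.edges.toFinset, hr, ?_, by simpa using hpe, ?_, ?_, ?_, ?_⟩
  · intro f hf
    exact (hHR f).1 (p.edges_subset_edgeSet (by simpa using hf))
  · intro d hd
    simpa using hmem d hd
  · intro f hf x hx
    obtain ⟨c, hc, rfl⟩ := List.mem_map.1 (List.mem_toFinset.1 hf)
    have hc' : c.toProd ∈ p.darts.map (fun d => d.toProd) := List.mem_map_of_mem hc
    rcases Sym2.mem_iff.1 (show x ∈ s(c.fst, c.snd) from hx) with rfl | rfl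
    · exact ⟨_, hc', rfl⟩
    · exact hr.exists_fst_eq_snd hc'
  · rw [List.toFinset_card_of_nodup htr.edges_nodup]
    simp
  · intro v
    have hsub : p.edges.toFinset ⊆ R := fun f hf =>
      (hHR f).1 (p.edges_subset_edgeSet (by simpa using hf))
    have h1 : Even (p.edges.toFinset.filter (v ∈ ·)).card :=
      (htr.even_card_filter_edges_iff v).2 (fun h => absurd rfl h)
    have h2 : (R \ p.edges.toFinset).filter (v ∈ ·) =
        R.filter (v ∈ ·) \ p.edges.toFinset.filter (v ∈ ·) := by
      ext f
      simp only [Finset.mem_filter, Finset.mem_sdiff]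
      tauto
    rw [h2, Finset.card_sdiff_of_subset (Finset.filter_subset_filter _ hsub)]
    exact (Nat.even_sub (Finset.card_le_card (Finset.filter_subset_filter _ hsub))).2
      (iff_of_true (hR v) h1)

/-- If `E` is an even set of edges covering all vertices and `E ∪ B` is connected, then some
tour visits every vertex, using edges of `E` at most once and edges of `B` at most twice. -/
theorem exists_isTour_visiting_all {V : Type*} [Fintype V] [DecidableEq V] [Nonempty V]
    {G : SimpleGraph V} {E B : Finset (Sym2 V)} (hEG : ∀ e ∈ E, e ∈ G.edgeSet)
    (hBG : ∀ e ∈ B, e ∈ G.edgeSet) (hEB : Disjoint E B) (heven : EvenIncidence E)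
    (hcov : ∀ v, ∃ e ∈ E, v ∈ e)
    (hcut : ∀ U : Set V, U.Nonempty → U ≠ Set.univ →
      ∃ u ∈ U, ∃ v ∉ U, s(u, v) ∈ E ∨ s(u, v) ∈ B) :
    ∃ (D : List (V × V)) (r : V → V → ℤ), IsTour G D r ∧ D ≠ [] ∧ (∀ v, ∃ d ∈ D, d.1 = v) ∧
      D.length ≤ E.card + 2 * B.card := by
  classical
  have key : ∀ (n : ℕ) (D : List (V × V)) (r : V → V → ℤ) (R Q : Finset (Sym2 V)),
      IsTour G D r → D ≠ [] → R ⊆ E → Q ⊆ B → EvenIncidence R →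
      (∀ d ∈ D, s(d.1, d.2) ∉ R ∧ s(d.1, d.2) ∉ Q) →
      (∀ e, (e ∈ E ∧ e ∉ R) ∨ (e ∈ B ∧ e ∉ Q) → ∀ x ∈ e, ∃ d ∈ D, d.1 = x) →
      D.length + R.card + 2 * Q.card ≤ E.card + 2 * B.card →
      (Finset.univ.filter fun x => ¬ ∃ d ∈ D, d.1 = x).card ≤ n →
      ∃ (D : List (V × V)) (r : V → V → ℤ), IsTour G D r ∧ D ≠ [] ∧ (∀ v, ∃ d ∈ D, d.1 = v) ∧
        D.length ≤ E.card + 2 * B.card := by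
    intro n
    induction n with
    | zero =>
      intro D r R Q hD hne _ _ _ _ _ hlen hn
      refine ⟨D, r, hD, hne, fun v => ?_, by omega⟩
      by_contra hv
      have : v ∈ Finset.univ.filter fun x => ¬ ∃ d ∈ D, d.1 = x := by simpa using hv
      rw [Finset.card_eq_zero.1 (Nat.le_zero.1 hn)] at this
      simp at this
    | succ n ih =>
      intro D r R Q hD hne hRE hQB hR hdisj hvis hlen hn
      by_cases hall : ∀ v, ∃ d ∈ D, d.1 = v
      · exact ⟨D, r, hD, hne, hall, by omega⟩
      obtain ⟨d₀, hd₀⟩ := List.exists_mem_of_ne_nil D hne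
      obtain ⟨u, ⟨o₁, ho₁, hou⟩, v, hv, huv⟩ := hcut {x | ∃ d ∈ D, d.1 = x} ⟨d₀.1, d₀, hd₀, rfl⟩
        (fun h => hall fun v => (h ▸ Set.mem_univ v : v ∈ {x | ∃ d ∈ D, d.1 = x}))
      have hER : ∀ e ∈ E, v ∈ e → e ∈ R := fun e he hve => by
        by_contra heR
        exact hv (hvis e (Or.inl ⟨he, heR⟩) v hve)
      have hBQ : ∀ e ∈ B, v ∈ e → e ∈ Q := fun e he hve => by
        by_contra heQ
        exact hv (hvis e (Or.inr ⟨he, heQ⟩) v hve)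
      have hRQ : ∀ e ∈ R, e ∉ Q := fun e he he' =>
        Finset.disjoint_left.1 hEB (hRE he) (hQB he')
      obtain ⟨e, heR, hve, hue⟩ : ∃ e ∈ R, v ∈ e ∧ (s(u, v) ∈ E → u ∈ e) := by
        by_cases h : s(u, v) ∈ E
        · exact ⟨s(u, v), hER _ h (by simp), by simp, by simp⟩
        · obtain ⟨e, he, hve⟩ := hcov v
          exact ⟨e, hER e he hve, hve, fun h' => absurd h' h⟩
      obtain ⟨D', r', Z, hD', hZR, heZ, hD'Z, hZD', hlen', hR'⟩ :=
        hR.exists_isTour (fun e he => hEG e (hRE he)) heR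
      obtain ⟨o₂, ho₂, hov⟩ := hZD' e heZ v hve
      have hdd : ∀ d ∈ D, d ∉ D' ∧ d.swap ∉ D' := by
        refine fun d hd => ⟨fun h => (hdisj d hd).1 (hZR (hD'Z d h)), fun h => ?_⟩
        have := hZR (hD'Z _ h)
        rw [Prod.fst_swap, Prod.snd_swap, Sym2.eq_swap] at this
        exact (hdisj d hd).1 this
      have hcard : (R \ Z).card + D'.length = R.card := by
        rw [hlen', Finset.card_sdiff_add_card_eq_card hZR]
      have hdec : ∀ D'' : List (V × V), (∀ d ∈ D, d ∈ D'') → o₂ ∈ D'' →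
          (Finset.univ.filter fun x => ¬ ∃ d ∈ D'', d.1 = x).card ≤ n := by
        intro D'' h1 h2
        refine Nat.le_of_lt_succ (lt_of_lt_of_le (Finset.card_lt_card ?_) hn)
        refine Finset.ssubset_iff_subset_ne.2 ⟨fun x hx => ?_, fun h => ?_⟩
        · simp only [Finset.mem_filter, Finset.mem_univ, true_and] at hx ⊢
          exact fun ⟨d, hd, hdx⟩ => hx ⟨d, h1 d hd, hdx⟩
        · have : v ∈ Finset.univ.filter fun x => ¬ ∃ d ∈ D, d.1 = x := by simpa using hv
          rw [← h] at this
          simp only [Finset.mem_filter, Finset.mem_univ, true_and] at this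
          exact this ⟨o₂, h2, hov⟩
      by_cases hmeet : ∃ d₁ ∈ D, ∃ d₂ ∈ D', d₁.1 = d₂.1
      · obtain ⟨d₁, hd₁, d₂, hd₂, hd⟩ := hmeet
        obtain ⟨D'', r'', hD'', hp⟩ := hD.splice hD' hdd hd₁ hd₂ hd
        have hm : ∀ d, d ∈ D'' ↔ d ∈ D ∨ d ∈ D' := fun d => by rw [hp.mem_iff, List.mem_append]
        refine ih D'' r'' (R \ Z) Q hD'' (List.ne_nil_of_mem ((hm d₁).2 (Or.inl hd₁)))
          (Finset.sdiff_subset.trans hRE) hQB hR' ?_ ?_ ?_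
          (hdec D'' (fun d hd => (hm d).2 (Or.inl hd)) ((hm o₂).2 (Or.inr ho₂)))
        · intro d hd
          rcases (hm d).1 hd with hd | hd
          · exact ⟨fun h => (hdisj d hd).1 (Finset.mem_sdiff.1 h).1, (hdisj d hd).2⟩
          · exact ⟨fun h => (Finset.mem_sdiff.1 h).2 (hD'Z d hd), hRQ _ (hZR (hD'Z d hd))⟩
        · intro f hf x hx
          by_cases hfZ : f ∈ Z
          · obtain ⟨d, hd, hdx⟩ := hZD' f hfZ x hx
            exact ⟨d, (hm d).2 (Or.inr hd), hdx⟩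
          · obtain ⟨d, hd, hdx⟩ := hvis f (by
              simp only [Finset.mem_sdiff] at hf
              tauto) x hx
            exact ⟨d, (hm d).2 (Or.inl hd), hdx⟩
        · rw [hp.length_eq, List.length_append]
          omega
      · have huvE : s(u, v) ∉ E := fun h => by
          obtain ⟨d₂, hd₂, hd₂u⟩ := hZD' e heZ u (hue h)
          exact hmeet ⟨o₁, ho₁, d₂, hd₂, hou.trans hd₂u.symm⟩
        have huvB : s(u, v) ∈ B := huv.resolve_left huvE
        have huvQ : s(u, v) ∈ Q := hBQ _ huvB (by simp)
        subst hou hov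
        obtain ⟨D'', r'', hD'', hp⟩ := hD.bridge hD' hdd ho₁ ho₂ (hBG _ huvB)
          (fun d hd h => (hdisj d hd).2 (h ▸ huvQ))
          (fun d hd h => hRQ _ (hZR (hD'Z d hd)) (h ▸ huvQ))
        have hm : ∀ d, d ∈ D'' ↔ d = (o₁.1, o₂.1) ∨ d = (o₂.1, o₁.1) ∨ d ∈ D ∨ d ∈ D' :=
          fun d => by rw [hp.mem_iff, List.mem_cons, List.mem_cons, List.mem_append]
        have hmD : ∀ d ∈ D, d ∈ D'' := fun d hd => (hm d).2 (Or.inr (Or.inr (Or.inl hd)))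
        have hmD' : ∀ d ∈ D', d ∈ D'' := fun d hd => (hm d).2 (Or.inr (Or.inr (Or.inr hd)))
        refine ih D'' r'' (R \ Z) (Q.erase s(o₁.1, o₂.1)) hD''
          (List.ne_nil_of_mem (hmD o₁ ho₁)) (Finset.sdiff_subset.trans hRE)
          ((Finset.erase_subset _ _).trans hQB) hR' ?_ ?_ ?_ (hdec D'' hmD (hmD' o₂ ho₂))
        · intro d hd
          rcases (hm d).1 hd with rfl | rfl | hd | hd
          · exact ⟨fun h => hRQ _ (Finset.mem_sdiff.1 h).1 huvQ, by simp⟩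
          · rw [Sym2.eq_swap]
            exact ⟨fun h => hRQ _ (Finset.mem_sdiff.1 h).1 huvQ, by simp⟩
          · exact ⟨fun h => (hdisj d hd).1 (Finset.mem_sdiff.1 h).1,
              fun h => (hdisj d hd).2 (Finset.mem_of_mem_erase h)⟩
          · exact ⟨fun h => (Finset.mem_sdiff.1 h).2 (hD'Z d hd),
              fun h => hRQ _ (hZR (hD'Z d hd)) (Finset.mem_of_mem_erase h)⟩
        · intro f hf x hx
          by_cases hfZ : f ∈ Z
          · obtain ⟨d, hd, hdx⟩ := hZD' f hfZ x hx
            exact ⟨d, hmD' d hd, hdx⟩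
          by_cases hfe : f = s(o₁.1, o₂.1)
          · rw [hfe] at hx
            rcases Sym2.mem_iff.1 hx with rfl | rfl
            · exact ⟨o₁, hmD o₁ ho₁, rfl⟩
            · exact ⟨o₂, hmD' o₂ ho₂, rfl⟩
          · obtain ⟨d, hd, hdx⟩ := hvis f (by
              simp only [Finset.mem_sdiff, Finset.mem_erase] at hf
              tauto) x hx
            exact ⟨d, hmD d hd, hdx⟩
        · have := Finset.card_erase_add_one huvQ
          rw [hp.length_eq, List.length_cons, List.length_cons, List.length_append]
          omega
  obtain ⟨v⟩ := ‹Nonempty V›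
  obtain ⟨e, he, hve⟩ := hcov v
  obtain ⟨D, r, Z, hD, hZE, heZ, hDZ, hZD, hlen, hE'⟩ := heven.exists_isTour hEG he
  obtain ⟨d, hd, -⟩ := hZD e heZ v hve
  refine key _ D r (E \ Z) B hD (List.ne_nil_of_mem hd) Finset.sdiff_subset subset_rfl hE'
    (fun d hd => ⟨fun h => (Finset.mem_sdiff.1 h).2 (hDZ d hd), fun h =>
      Finset.disjoint_left.1 hEB (hZE (hDZ d hd)) h⟩) ?_ ?_ le_rfl
  · intro f hf
    simp only [Finset.mem_sdiff] at hf
    exact hZD f (by tauto)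
  · have := Finset.card_sdiff_add_card_eq_card hZE
    omega

theorem Finset.even_card_filter_symmDiff {α : Type*} [DecidableEq α] (A B : Finset α)
    (p : α → Prop) [DecidablePred p] :
    Even ((symmDiff A B).filter p).card ↔ (Even (A.filter p).card ↔ Even (B.filter p).card) := by
  have h1 : ((symmDiff A B).filter p).card
      = ((A \ B).filter p).card + ((B \ A).filter p).card := by
    rw [← Finset.card_union_of_disjoint (Finset.disjoint_filter_filter disjoint_sdiff_sdiff),
      ← Finset.filter_union]
    rfl
  have h2 : (A.filter p).card = ((A \ B).filter p).card + ((A ∩ B).filter p).card := by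
    rw [← Finset.card_union_of_disjoint
      (Finset.disjoint_filter_filter (Finset.disjoint_sdiff_inter A B)), ← Finset.filter_union,
      Finset.sdiff_union_inter]
  have h3 : (B.filter p).card = ((B \ A).filter p).card + ((A ∩ B).filter p).card := by
    rw [Finset.inter_comm, ← Finset.card_union_of_disjoint
      (Finset.disjoint_filter_filter (Finset.disjoint_sdiff_inter B A)), ← Finset.filter_union,
      Finset.sdiff_union_inter]
  rw [h1, h2, h3]
  simp only [Nat.even_add]
  tauto

/-- In a connected graph, any edge set can be matched by a set of edges of the graph
having the same parity at every vertex. -/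
theorem SimpleGraph.Connected.exists_same_parity {V : Type*} [DecidableEq V]
    {T : SimpleGraph V} (hT : T.Connected) (F : Finset (Sym2 V)) (hF : ∀ e ∈ F, ¬ e.IsDiag) :
    ∃ J : Finset (Sym2 V), (∀ e ∈ J, e ∈ T.edgeSet) ∧
      ∀ v, Even (F.filter (v ∈ ·)).card ↔ Even (J.filter (v ∈ ·)).card := by
  induction F using Finset.induction_on with
  | empty => exact ⟨∅, by simp, by simp⟩
  | insert e F he ih =>
    obtain ⟨J, hJT, hJ⟩ := ih fun f hf => hF f (Finset.mem_insert_of_mem hf)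
    have hd := hF e (Finset.mem_insert_self _ _)
    induction e using Sym2.ind with | _ a b
    obtain ⟨p, hp⟩ := (hT.preconnected a b).exists_isPath
    refine ⟨symmDiff J p.edges.toFinset, ?_, fun v => ?_⟩
    · intro f hf
      rcases Finset.mem_symmDiff.1 hf with h | h
      · exact hJT f h.1
      · exact p.edges_subset_edgeSet (List.mem_toFinset.1 h.1)
    · rw [Finset.even_card_filter_symmDiff, hp.isTrail.even_card_filter_edges_iff, ← hJ,
        Finset.filter_insert]
      have hab : a ≠ b := by simpa using hd
      split_ifs with hv
      · rw [Finset.card_insert_of_notMem (by simp [he]), Nat.even_add_one]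
        rw [Sym2.mem_iff] at hv
        tauto
      · rw [Sym2.mem_iff] at hv
        tauto

theorem SimpleGraph.Connected.exists_adj_boundary {V : Type*} {T : SimpleGraph V}
    (hT : T.Connected) {U : Set V} (hU : U.Nonempty) (hU' : U ≠ Set.univ) :
    ∃ u ∈ U, ∃ v ∉ U, T.Adj u v := by
  obtain ⟨a, ha⟩ := hU
  obtain ⟨b, hb⟩ := (Set.ne_univ_iff_exists_notMem U).1 hU'
  obtain ⟨p⟩ := hT.preconnected a b
  obtain ⟨d, -, hd1, hd2⟩ := p.exists_boundary_dart U ha hb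
  exact ⟨d.fst, hd1, d.snd, hd2, d.adj⟩

/-- If a finite connected graph `G` on `n` vertices has a spanning tree `T` in which no
vertex is saturated (every vertex has an incident edge of `G` outside `T`), then there is
a port numbering and a closed RH-walk visiting all vertices of length at most `2n`. -/
theorem terse_witness_cycle {V : Type*} [Fintype V] (G T : SimpleGraph V)
    (hconn : G.Connected) (hle : T ≤ G) (htree : T.IsTree)
    (hnosat : ∀ v : V, ∃ u : V, G.Adj v u ∧ ¬ T.Adj v u) :
    ∃ π : V → V → ℕ, IsPortNumbering G π ∧
      ∃ (L : ℕ) (w : ℕ → V), IsClosedRHWalk G π L w ∧ VisitsAll L w ∧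
        L ≤ 2 * Fintype.card V := by
  classical
  have : Nonempty V := hconn.nonempty
  obtain ⟨K, hKle, hKac, hKreach⟩ := SimpleGraph.exists_isAcyclic_reachable_eq_le (G := G \ T)
  have hKinc : ∀ v, ∃ u, K.Adj v u := by
    intro v
    obtain ⟨u, huv, hTuv⟩ := hnosat v
    have hr : K.Reachable v u := by
      rw [hKreach]
      exact SimpleGraph.Adj.reachable ⟨huv, hTuv⟩
    obtain ⟨p⟩ := hr
    obtain ⟨d, -, hd, -⟩ := p.exists_boundary_dart {v} rfl huv.ne'
    exact ⟨d.snd, (Set.mem_singleton_iff.1 hd) ▸ d.adj⟩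
  obtain ⟨S, hKS, hSle, hS⟩ :=
    (htree.connected.mono (le_sup_right : T ≤ K ⊔ T)).exists_isTree_le_of_le_of_isAcyclic
      le_sup_left hKac
  obtain ⟨J, hJT, hJ⟩ := htree.connected.exists_same_parity K.edgeFinset fun e he =>
    K.not_isDiag_of_mem_edgeSet (SimpleGraph.mem_edgeFinset.1 he)
  have hKT : ∀ e ∈ K.edgeSet, e ∉ T.edgeSet := by
    intro e he
    induction e using Sym2.ind with | _ a b
    exact (hKle he).2
  have hKJ : Disjoint K.edgeFinset J := Finset.disjoint_left.2 fun e he he' =>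
    hKT e (SimpleGraph.mem_edgeFinset.1 he) (hJT e he')
  set B := S.edgeFinset \ (K.edgeFinset ∪ J) with hB
  have hBT : B ⊆ T.edgeFinset := by
    intro e he
    induction e using Sym2.ind with | _ a b
    simp only [hB, Finset.mem_sdiff, Finset.mem_union, SimpleGraph.mem_edgeFinset,
      SimpleGraph.mem_edgeSet, not_or] at he ⊢
    exact (hSle he.1).resolve_left he.2.1
  have hcard : (K.edgeFinset ∪ J).card + 2 * B.card ≤ 2 * Fintype.card V := by
    have hTc := htree.card_edgeFinset
    have hSc := hS.card_edgeFinset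
    have h1 : K.edgeFinset.card + B.card ≤ S.edgeFinset.card := by
      rw [← Finset.card_union_of_disjoint
        (Finset.disjoint_sdiff.mono_left Finset.subset_union_left)]
      exact Finset.card_le_card
        (Finset.union_subset (SimpleGraph.edgeFinset_mono hKS) Finset.sdiff_subset)
    have h2 : J.card + B.card ≤ T.edgeFinset.card := by
      rw [← Finset.card_union_of_disjoint
        (Finset.disjoint_sdiff.mono_left Finset.subset_union_right)]
      exact Finset.card_le_card
        (Finset.union_subset (fun e he => SimpleGraph.mem_edgeFinset.2 (hJT e he)) hBT)
    have h3 := Finset.card_union_le K.edgeFinset J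
    omega
  have hTG : ∀ e ∈ T.edgeSet, e ∈ G.edgeSet := SimpleGraph.edgeSet_mono hle
  obtain ⟨D, r, hD, hne, hvis, hlen⟩ := exists_isTour_visiting_all (G := G)
    (E := K.edgeFinset ∪ J) (B := B)
    (by
      intro e he
      rcases Finset.mem_union.1 he with h | h
      · exact SimpleGraph.edgeSet_mono (hKle.trans sdiff_le) (SimpleGraph.mem_edgeFinset.1 h)
      · exact hTG e (hJT e h))
    (fun e he => hTG e (SimpleGraph.mem_edgeFinset.1 (hBT he)))
    Finset.disjoint_sdiff
    (by
      intro v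
      rw [Finset.filter_union, Finset.card_union_of_disjoint
        (Finset.disjoint_filter_filter hKJ), Nat.even_add]
      exact hJ v)
    (by
      intro v
      obtain ⟨u, hu⟩ := hKinc v
      exact ⟨s(v, u), by simp [hu], Sym2.mem_mk_left v u⟩)
    (by
      intro U hU hU'
      obtain ⟨u, hu, v, hv, huv⟩ := hS.connected.exists_adj_boundary hU hU'
      refine ⟨u, hu, v, hv, ?_⟩
      by_cases h : s(u, v) ∈ K.edgeFinset ∪ J
      · exact Or.inl h
      · exact Or.inr (Finset.mem_sdiff.2 ⟨SimpleGraph.mem_edgeFinset.2 huv, h⟩))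
  obtain ⟨π, hπ, w, hw, hwD⟩ := hD.exists_isClosedRHWalk hne
  refine ⟨π, hπ, D.length, w, hw, fun v => ?_, hlen.trans hcard⟩
  obtain ⟨d, hd, rfl⟩ := hvis v
  exact hwD d hd
end

section
/- Every finite connected simple graph G admits a three-layer partition: there exist a partition of the vertex set V into sets X, Y, Z with X nonempty, and a subgraph T_B of G, such that Y = N_G(X), Z = N_G(Y) \ X, T_B is a tree whose vertex set is exactly X ∪ Y, and every edge of G incident to a vertex of X is an edge of T_B. -/
/-- The neighborhood of a set `X`: vertices outside `X` having a neighbor in `X`. -/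
def setNbhd {V : Type*} (G : SimpleGraph V) (X : Set V) : Set V :=
  {v : V | v ∉ X ∧ ∃ x ∈ X, G.Adj x v}

/-- A three-layer partition of `G`: `X`, `Y`, `Z` partition the vertices,
`Y = N_G(X)`, `Z = N_G(Y) \ X`, and `T` is a subgraph of `G` which is a tree with
vertex set exactly `X ∪ Y` in which every vertex of `X` is saturated. -/
def IsThreeLayerPartition {V : Type*} (G : SimpleGraph V)
    (X Y Z : Set V) (T : G.Subgraph) : Prop :=
  X ∪ Y ∪ Z = Set.univ ∧ Disjoint X Y ∧ Disjoint X Z ∧ Disjoint Y Z ∧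
  Y = setNbhd G X ∧ Z = setNbhd G Y \ X ∧
  T.verts = X ∪ Y ∧ T.coe.IsTree ∧
  (∀ x ∈ X, ∀ u : V, G.Adj x u → T.Adj x u)

/-- A subgraph that is connected and has no cycle. -/
def IsSubtree {V : Type*} {G : SimpleGraph V} (T : G.Subgraph) : Prop :=
  T.Connected ∧ T.spanningCoe.IsAcyclic

theorem IsSubtree.isTree_coe {V : Type*} {G : SimpleGraph V} {T : G.Subgraph}
    (hT : IsSubtree T) : T.coe.IsTree :=
  ⟨hT.1.coe, hT.2.embedding T.coeEmbeddingSpanningCoe⟩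

theorem isSubtree_singletonSubgraph {V : Type*} (G : SimpleGraph V) (v : V) :
    IsSubtree (G.singletonSubgraph v) := by
  refine ⟨SimpleGraph.Subgraph.singletonSubgraph_connected, ?_⟩
  convert! SimpleGraph.isAcyclic_bot (V := V)

theorem not_reachable_spanningCoe_of_notMem_verts {V : Type*} {G : SimpleGraph V}
    {T : G.Subgraph} {u v : V} (hu : u ∈ T.verts) (hv : v ∉ T.verts) :
    ¬ T.spanningCoe.Reachable u v := by
  rintro ⟨p⟩
  obtain ⟨d, -, -, hd⟩ := p.exists_boundary_dart T.verts hu hv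
  exact hd (T.edge_vert d.adj.symm)

theorem IsSubtree.sup_subgraphOfAdj {V : Type*} {G : SimpleGraph V} {T : G.Subgraph}
    (hT : IsSubtree T) {u v : V} (h : G.Adj u v) (hu : u ∈ T.verts) (hv : v ∉ T.verts) :
    IsSubtree (T ⊔ G.subgraphOfAdj h) := by
  refine ⟨SimpleGraph.Subgraph.connected_sup hT.1.preconnected
    (SimpleGraph.Subgraph.subgraphOfAdj_connected h).preconnected ⟨u, hu, by simp⟩, ?_⟩
  rw [SimpleGraph.Subgraph.sup_spanningCoe, SimpleGraph.Subgraph.spanningCoe_subgraphOfAdj]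
  exact hT.2.sup_edge_of_not_reachable (not_reachable_spanningCoe_of_notMem_verts hu hv)

/-- A finite set of outside neighbors of a vertex can be attached to a subtree as leaves. -/
theorem IsSubtree.exists_attach_leaves {V : Type*} {G : SimpleGraph V} {T : G.Subgraph}
    (hT : IsSubtree T) {w : V} (hw : w ∈ T.verts) {S : Set V} (hS : S.Finite)
    (hadj : ∀ u ∈ S, G.Adj w u) (hdisj : ∀ u ∈ S, u ∉ T.verts) :
    ∃ T' : G.Subgraph, IsSubtree T' ∧ T ≤ T' ∧ T'.verts = T.verts ∪ S ∧
      ∀ u ∈ S, T'.Adj w u := by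
  induction S, hS using Set.Finite.induction_on with
  | empty => exact ⟨T, hT, le_rfl, by simp, by simp⟩
  | @insert a S ha _ ih =>
    obtain ⟨T', hT', hle, hverts, hT'adj⟩ := ih (fun u hu ↦ hadj u (.inr hu))
      (fun u hu ↦ hdisj u (.inr hu))
    have haT : a ∉ T'.verts := by
      rw [hverts]
      exact fun h ↦ h.elim (hdisj a (.inl rfl)) ha
    have hwa := hadj a (.inl rfl)
    refine ⟨T' ⊔ G.subgraphOfAdj hwa, hT'.sup_subgraphOfAdj hwa (hle.1 hw) haT,
      hle.trans le_sup_left, ?_, ?_⟩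
    · ext x
      simp only [SimpleGraph.Subgraph.verts_sup, SimpleGraph.subgraphOfAdj_verts, hverts]
      grind
    · rintro u (rfl | hu)
      · exact .inr (by simp)
      · exact .inl (hT'adj u hu)

/-- A set `X` is saturable if some subtree with vertex set `X ∪ N(X)` contains all edges
incident to `X`. -/
def IsSaturable {V : Type*} (G : SimpleGraph V) (X : Set V) : Prop :=
  ∃ T : G.Subgraph, IsSubtree T ∧ T.verts = X ∪ setNbhd G X ∧
    ∀ x ∈ X, ∀ u : V, G.Adj x u → T.Adj x u

theorem isSaturable_singleton {V : Type*} [Finite V] (G : SimpleGraph V) (v : V) :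
    IsSaturable G {v} := by
  obtain ⟨T, hT, -, hverts, hadj⟩ := (isSubtree_singletonSubgraph G v).exists_attach_leaves
    (w := v) (by simp) (Set.toFinite (G.neighborSet v)) (fun _ h ↦ h)
    (fun u h hu ↦ G.ne_of_adj h (by simpa using hu.symm))
  refine ⟨T, hT, ?_, ?_⟩
  · rw [hverts]
    ext x
    simp only [SimpleGraph.singletonSubgraph_verts, setNbhd, Set.mem_union, Set.mem_ofPred_eq,
      Set.mem_singleton_iff, SimpleGraph.mem_neighborSet, exists_eq_left]
    tauto
  · rintro x rfl u hu
    exact hadj u hu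

/-- A saturable set can be enlarged by any vertex at distance exactly three from it. -/
theorem IsSaturable.insert {V : Type*} [Finite V] {G : SimpleGraph V} {X : Set V}
    (hX : IsSaturable G X) {y z w : V} (hy : y ∈ setNbhd G X) (hyz : G.Adj y z)
    (hzw : G.Adj z w) (hw : w ∉ X ∪ setNbhd G X) (hw' : w ∉ setNbhd G (setNbhd G X)) :
    IsSaturable G (insert w X) := by
  obtain ⟨T, hT, hverts, hsat⟩ := hX
  have hfar : ∀ u ∈ X ∪ setNbhd G X, ¬ G.Adj w u := by
    rintro u (hu | hu) h
    · exact hw (.inr ⟨fun h' ↦ hw (.inl h'), u, hu, h.symm⟩)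
    · exact hw' ⟨fun h' ↦ hw (.inr h'), u, hu, h.symm⟩
  have hz : z ∉ X ∪ setNbhd G X := fun h ↦ hfar z h hzw.symm
  have hwz : w ≠ z := hzw.ne'
  have hwy : w ≠ y := fun h ↦ hw (.inr (h ▸ hy))
  have hTz := hT.sup_subgraphOfAdj hyz (hverts ▸ .inr hy) (hverts ▸ hz)
  have hTw := hTz.sup_subgraphOfAdj hzw (by simp)
    (by simpa [hverts, hwz, hwy] using hw)
  obtain ⟨T', hT', hle, hverts', hadj'⟩ := hTw.exists_attach_leaves (w := w) (by simp)
    (Set.toFinite (G.neighborSet w \ {z})) (fun _ h ↦ h.1) (by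
      rintro u ⟨hu, huz⟩
      have hwu := G.ne_of_adj hu
      have := fun h ↦ hfar u h hu
      simp only [SimpleGraph.Subgraph.verts_sup, SimpleGraph.subgraphOfAdj_verts, hverts]
      grind)
  refine ⟨T', hT', ?_, ?_⟩
  · rw [hverts']
    ext x
    have := hfar x
    simp only [SimpleGraph.Subgraph.verts_sup, SimpleGraph.subgraphOfAdj_verts, hverts]
    simp only [setNbhd, Set.mem_union, Set.mem_ofPred_eq, Set.mem_insert_iff, Set.mem_sdiff,
      SimpleGraph.mem_neighborSet, Set.mem_singleton_iff] at *
    have := hzw.symm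
    grind
  · rintro x (rfl | hx) u hu
    · by_cases huz : u = z
      · subst huz
        exact hle.2 (.inr (by simp))
      · exact hadj' u ⟨hu, huz⟩
    · exact hle.2 (.inl (.inl (hsat x hx u hu)))

/-- Every finite connected simple graph admits a three-layer partition with `X` nonempty. -/
theorem exists_three_layer_partition {V : Type*} [Fintype V] (G : SimpleGraph V)
    (hconn : G.Connected) :
    ∃ (X Y Z : Set V) (T : G.Subgraph),
      X.Nonempty ∧ IsThreeLayerPartition G X Y Z T := by
  obtain ⟨v⟩ := hconn.nonempty
  obtain ⟨X, hvX, hmax⟩ := (Set.toFinite {X : Set V | IsSaturable G X}).exists_le_maximal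
    (isSaturable_singleton G v)
  have hX : IsSaturable G X := hmax.prop
  have hv : v ∈ X := hvX rfl
  have hcover : ∀ w, w ∈ X ∪ setNbhd G X ∪ setNbhd G (setNbhd G X) := by
    by_contra! ⟨w, hw⟩
    obtain ⟨p⟩ := hconn.preconnected v w
    obtain ⟨⟨⟨z, w'⟩, hzw⟩, -, hz, hw'⟩ := p.exists_boundary_dart
      (X ∪ setNbhd G X ∪ setNbhd G (setNbhd G X)) (.inl (.inl hv)) hw
    have hwX : w' ∉ X := fun h ↦ hw' (.inl (.inl h))
    have hwY : w' ∉ setNbhd G X := fun h ↦ hw' (.inl (.inr h))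
    have hwZ : w' ∉ setNbhd G (setNbhd G X) := fun h ↦ hw' (.inr h)
    rcases hz with (hz | hz) | ⟨-, y, hy, hyz⟩
    · exact hwY ⟨hwX, z, hz, hzw⟩
    · exact hwZ ⟨hwY, z, hz, hzw⟩
    · exact hwX (hmax.le_of_ge (hX.insert hy hyz hzw (not_or.2 ⟨hwX, hwY⟩) hwZ)
        (Set.subset_insert w' X) (Set.mem_insert w' X))
  obtain ⟨T, hT, hverts, hsat⟩ := hX
  refine ⟨X, setNbhd G X, setNbhd G (setNbhd G X) \ X, T, ⟨v, hv⟩, ?_, ?_, ?_, ?_, rfl, rfl,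
    hverts, hT.isTree_coe, hsat⟩
  · ext w
    have := hcover w
    simp only [Set.mem_union, Set.mem_sdiff, Set.mem_univ, iff_true] at this ⊢
    tauto
  · exact Set.disjoint_left.2 fun _ h h' ↦ h'.1 h
  · exact Set.disjoint_sdiff_right
  · exact Set.disjoint_left.2 fun _ h h' ↦ h'.1.1 h
end

section
/- Every finite connected simple graph G admits a three-layer partition (X, Y, Z, T_B) that additionally satisfies: (1) every vertex of Y is joined, by an edge of G that is not an edge of T_B, to another vertex of Y (a horizontal edge outside T_B); and (2) every vertex of Z has at least two neighbors in Y. -/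
namespace SimpleGraph.Subgraph

variable {V : Type*} {G : SimpleGraph V} {T : G.Subgraph} {X : Set V} {u v : V}

/-- A subgraph which, on its own vertex set, is a tree. -/
structure IsSubtree (T : G.Subgraph) : Prop where
  connected : T.Connected
  isAcyclic : T.spanningCoe.IsAcyclic

theorem IsSubtree.coe_isTree (hT : T.IsSubtree) : T.coe.IsTree where
  connected := hT.connected.coe
  isAcyclic := hT.isAcyclic.comap ⟨Subtype.val, fun h ↦ h⟩ Subtype.val_injective

theorem isSubtree_singletonSubgraph (v : V) : (G.singletonSubgraph v).IsSubtree where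
  connected := singletonSubgraph_connected
  isAcyclic := isAcyclic_bot.anti fun _ _ h ↦ h.elim

/-- Attaching a leaf to a subtree gives a subtree. -/
theorem IsSubtree.sup_subgraphOfAdj (hT : T.IsSubtree) (h : G.Adj v u) (hv : v ∈ T.verts)
    (hu : u ∉ T.verts) : (T ⊔ G.subgraphOfAdj h).IsSubtree where
  connected := connected_sup hT.connected.preconnected
    (subgraphOfAdj_connected h).preconnected ⟨v, hv, by simp⟩
  isAcyclic := by
    have hreach : ¬ T.spanningCoe.Reachable v u :=
      not_reachable_of_neighborSet_right_eq_empty h.ne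
        (Set.eq_empty_of_forall_notMem fun _ hw ↦ hu (T.edge_vert hw))
    refine (hT.isAcyclic.sup_edge_of_not_reachable hreach).anti fun a b hab ↦ ?_
    rcases hab with hab | hab
    · exact .inl hab
    · exact .inr ((adj_edge _ _).2 ⟨hab, (adj_sub _ hab).ne⟩)

/-- Finitely many leaves can be attached to a vertex of a subtree simultaneously. -/
theorem IsSubtree.exists_attach_leaves (hT : T.IsSubtree) (hv : v ∈ T.verts) {S : Set V}
    (hS : S.Finite) (hST : Disjoint S T.verts) (hadj : ∀ s ∈ S, G.Adj v s) :
    ∃ T' : G.Subgraph, T'.IsSubtree ∧ T ≤ T' ∧ T'.verts = T.verts ∪ S ∧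
      ∀ s ∈ S, T'.Adj v s := by
  induction S, hS using Set.Finite.induction_on with
  | empty => exact ⟨T, hT, le_rfl, by simp, by simp⟩
  | @insert a S ha _ ih =>
    rw [Set.disjoint_insert_left] at hST
    obtain ⟨T', hT', hle, hverts, hS'⟩ := ih hST.2 fun s hs ↦ hadj s (.inr hs)
    have hva := hadj a (.inl rfl)
    have haT' : a ∉ T'.verts := by simp [hverts, hST.1, ha]
    refine ⟨T' ⊔ G.subgraphOfAdj hva, hT'.sup_subgraphOfAdj hva (hle.1 hv) haT',
      hle.trans le_sup_left, ?_, ?_⟩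
    · ext w
      simp only [verts_sup, hverts, subgraphOfAdj_verts, Set.mem_union, Set.mem_insert_iff,
        Set.mem_singleton_iff]
      grind
    · rintro s (rfl | hs)
      · exact .inr rfl
      · exact .inl (hS' s hs)

/-- `T` is a subtree with vertex set `X ∪ N(X)` that saturates every vertex of `X`. -/
structure IsSaturatingTree (T : G.Subgraph) (X : Set V) : Prop where
  isSubtree : T.IsSubtree
  verts_eq : T.verts = X ∪ setNbhd G X
  adj_of_adj : ∀ x ∈ X, ∀ u, G.Adj x u → T.Adj x u

/-- A subtree containing every edge of `G` between `v` and its vertices extends to a tree that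
also saturates `v`. -/
theorem IsSubtree.exists_isSaturatingTree_insert [Finite V] (hT : T.IsSubtree)
    (hv : v ∈ T.verts) (hX : X ⊆ T.verts) (hsat : ∀ x ∈ X, ∀ u, G.Adj x u → T.Adj x u)
    (hvT : ∀ u ∈ T.verts, G.Adj v u → T.Adj v u)
    (hverts : T.verts ⊆ insert v X ∪ setNbhd G (insert v X)) :
    ∃ T' : G.Subgraph, T'.IsSaturatingTree (insert v X) := by
  obtain ⟨T', hT', hle, hverts', hadj⟩ := hT.exists_attach_leaves hv
    (Set.toFinite (G.neighborSet v \ T.verts)) Set.disjoint_sdiff_left fun s hs ↦ hs.1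
  have hsat' : ∀ x ∈ insert v X, ∀ u, G.Adj x u → T'.Adj x u := by
    rintro x (rfl | hx) u hu
    · by_cases huT : u ∈ T.verts
      · exact hle.2 (hvT u huT hu)
      · exact hadj u ⟨hu, huT⟩
    · exact hle.2 (hsat x hx u hu)
  refine ⟨T', hT', subset_antisymm ?_ ?_, hsat'⟩
  · rw [hverts']
    refine Set.union_subset hverts fun u hu ↦ ?_
    by_cases hmem : u ∈ insert v X
    · exact .inl hmem
    · exact .inr ⟨hmem, v, .inl rfl, hu.1⟩
  · rintro u (hu | ⟨-, x, hx, hxu⟩)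
    · exact hle.1 (Set.insert_subset hv hX hu)
    · exact T'.edge_vert (hsat' x hx u hxu).symm

namespace IsSaturatingTree

theorem subset_verts (hT : T.IsSaturatingTree X) : X ⊆ T.verts :=
  hT.verts_eq ▸ Set.subset_union_left

theorem verts_subset_insert (hT : T.IsSaturatingTree X) (z : V) :
    T.verts ⊆ insert z X ∪ setNbhd G (insert z X) := by
  rw [hT.verts_eq]
  rintro u (hu | ⟨-, x, hx, hxu⟩)
  · exact .inl (.inr hu)
  · by_cases hmem : u ∈ insert z X
    · exact .inl hmem
    · exact .inr ⟨hmem, x, .inr hx, hxu⟩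

variable [Finite V]

/-- A vertex of `N(X)` all of whose horizontal edges lie in the tree can be added to `X`. -/
theorem exists_insert_of_mem_setNbhd (hT : T.IsSaturatingTree X) (hv : v ∈ setNbhd G X)
    (h : ∀ u ∈ setNbhd G X, G.Adj v u → T.Adj v u) :
    ∃ T' : G.Subgraph, T'.IsSaturatingTree (insert v X) := by
  refine hT.isSubtree.exists_isSaturatingTree_insert (hT.verts_eq ▸ .inr hv) hT.subset_verts
    hT.adj_of_adj (fun u hu hvu ↦ ?_) (hT.verts_subset_insert v)
  rw [hT.verts_eq] at hu
  rcases hu with hu | hu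
  · exact (hT.adj_of_adj u hu v hvu.symm).symm
  · exact h u hu hvu

/-- A vertex outside `X ∪ N(X)` with a unique neighbor in `N(X)` can be added to `X`. -/
theorem exists_insert_of_unique_adj {y z : V} (hT : T.IsSaturatingTree X) (hz : z ∉ T.verts)
    (hy : y ∈ setNbhd G X) (hyz : G.Adj y z) (huniq : ∀ u ∈ setNbhd G X, G.Adj z u → u = y) :
    ∃ T' : G.Subgraph, T'.IsSaturatingTree (insert z X) := by
  have hyT : y ∈ T.verts := hT.verts_eq ▸ .inr hy
  refine (hT.isSubtree.sup_subgraphOfAdj hyz hyT hz).exists_isSaturatingTree_insert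
    (.inr (by simp)) (hT.subset_verts.trans Set.subset_union_left)
    (fun x hx u hxu ↦ .inl (hT.adj_of_adj x hx u hxu)) (fun u hu hzu ↦ ?_) ?_
  · have huT : u ∈ T.verts := by
      rcases hu with hu | rfl | rfl
      exacts [hu, hyT, (hzu.ne rfl).elim]
    rw [hT.verts_eq] at huT
    rcases huT with hu | hu
    · exact (hz (T.edge_vert (hT.adj_of_adj u hu z hzu.symm).symm)).elim
    · obtain rfl := huniq u hu hzu
      exact .inr Sym2.eq_swap
  · refine Set.union_subset (hT.verts_subset_insert z) ?_
    rintro u (rfl | rfl)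
    · exact hT.verts_subset_insert z hyT
    · exact .inl (.inl rfl)

/-- A vertex with no neighbor in `X ∪ N(X)`, but at distance two from `N(X)`, can be added
to `X`. -/
theorem exists_insert_of_adj_adj {y w z : V} (hT : T.IsSaturatingTree X) (hz : z ∉ T.verts)
    (hw : w ∉ T.verts) (hy : y ∈ setNbhd G X) (hyw : G.Adj y w) (hwz : G.Adj w z)
    (hnone : ∀ u ∈ T.verts, ¬ G.Adj z u) :
    ∃ T' : G.Subgraph, T'.IsSaturatingTree (insert z X) := by
  have hyT : y ∈ T.verts := hT.verts_eq ▸ .inr hy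
  have hzy : z ≠ y := fun h ↦ hz (h ▸ hyT)
  refine ((hT.isSubtree.sup_subgraphOfAdj hyw hyT hw).sup_subgraphOfAdj hwz (.inr (by simp))
    (by simp [hz, hzy, hwz.ne'])).exists_isSaturatingTree_insert
    (.inr (by simp)) (fun x hx ↦ .inl (.inl (hT.subset_verts hx)))
    (fun x hx u hxu ↦ .inl (.inl (hT.adj_of_adj x hx u hxu))) (fun u hu hzu ↦ ?_) ?_
  · rcases hu with (hu | rfl | rfl) | rfl | rfl
    · exact (hnone u hu hzu).elim
    · exact (hnone u hyT hzu).elim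
    · exact .inr Sym2.eq_swap
    · exact .inr Sym2.eq_swap
    · exact (hzu.ne rfl).elim
  · have hzmem : z ∈ insert z X := .inl rfl
    have hwmem : w ∈ insert z X ∪ setNbhd G (insert z X) := by
      refine .inr ⟨?_, z, hzmem, hwz.symm⟩
      rintro (h | h)
      · exact hwz.ne h
      · exact hw (hT.subset_verts h)
    rintro u ((hu | rfl | rfl) | rfl | rfl)
    exacts [hT.verts_subset_insert z hu, hT.verts_subset_insert z hyT, hwmem, hwmem, .inl hzmem]

end IsSaturatingTree

/-- There is a saturating tree whose set of saturated vertices is nonempty and maximal. -/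
theorem exists_maximal_isSaturatingTree [Finite V] [Nonempty V] (G : SimpleGraph V) :
    ∃ (X : Set V) (T : G.Subgraph), X.Nonempty ∧ T.IsSaturatingTree X ∧
      ∀ (v : V) (T' : G.Subgraph), T'.IsSaturatingTree (insert v X) → v ∈ X := by
  let v : V := Classical.arbitrary V
  obtain ⟨T₀, hT₀⟩ := (isSubtree_singletonSubgraph (G := G) v).exists_isSaturatingTree_insert
    (v := v) (X := ∅) rfl (Set.empty_subset _) (by simp)
    (by rintro u rfl hu; exact (hu.ne rfl).elim) (by rintro u rfl; exact .inl (.inl rfl))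
  obtain ⟨X, ⟨hne, T, hT⟩, hmax⟩ :=
    (Set.toFinite {X : Set V | X.Nonempty ∧ ∃ T : G.Subgraph, T.IsSaturatingTree X}).exists_maximal
      ⟨insert v ∅, Set.insert_nonempty _ _, T₀, hT₀⟩
  exact ⟨X, T, hne, hT, fun w T' hT' ↦
    hmax ⟨Set.insert_nonempty _ _, T', hT'⟩ (Set.subset_insert w X) (.inl rfl)⟩

end SimpleGraph.Subgraph

/-- Every finite connected simple graph admits a three-layer partition `(X, Y, Z, T)`
such that (1) every vertex of `Y` has an incident horizontal edge (to another vertex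
of `Y`) outside of `T`, and (2) every vertex of `Z` has at least two neighbors in `Y`. -/
theorem exists_three_layer_partition_with_properties {V : Type*} [Fintype V]
    (G : SimpleGraph V) (hconn : G.Connected) :
    ∃ (X Y Z : Set V) (T : G.Subgraph),
      IsThreeLayerPartition G X Y Z T ∧
      (∀ y ∈ Y, ∃ y' ∈ Y, G.Adj y y' ∧ ¬ T.Adj y y') ∧
      (∀ z ∈ Z, ∃ y₁ ∈ Y, ∃ y₂ ∈ Y, y₁ ≠ y₂ ∧ G.Adj z y₁ ∧ G.Adj z y₂) := by
  have := hconn.nonempty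
  obtain ⟨X, T, ⟨x₀, hx₀⟩, hT, hmax⟩ := SimpleGraph.Subgraph.exists_maximal_isSaturatingTree G
  have hmem : ∀ v, v ∈ T.verts ↔ v ∈ X ∨ v ∈ setNbhd G X := fun v ↦ by
    rw [hT.verts_eq, Set.mem_union]
  have hXY : Disjoint X (setNbhd G X) := Set.disjoint_left.2 fun x hx hx' ↦ hx'.1 hx
  have hcover : ∀ v, v ∈ X ∪ setNbhd G X ∪ (setNbhd G (setNbhd G X) \ X) := by
    by_contra! ⟨z₀, hz₀⟩
    obtain ⟨p⟩ := hconn.preconnected x₀ z₀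
    obtain ⟨⟨⟨w, z⟩, hwz⟩, -, hw, hz⟩ := p.exists_boundary_dart _ (.inl (.inl hx₀)) hz₀
    replace hwz : G.Adj w z := hwz
    simp only [Set.mem_union, Set.mem_sdiff, not_or, not_and, not_not] at hw hz
    obtain ⟨⟨hzX, hzY⟩, hzZ⟩ := hz
    have hz_adj : ∀ u ∈ T.verts, ¬ G.Adj z u := fun u hu hzu ↦ by
      rcases (hmem u).1 hu with hu | hu
      · exact hzY ⟨hzX, u, hu, hzu.symm⟩
      · exact hzX (hzZ ⟨hzY, u, hu, hzu.symm⟩)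
    have hwT : w ∉ T.verts := fun hw ↦ hz_adj w hw hwz.symm
    have hw' := mt (hmem w).2 hwT
    obtain ⟨⟨-, y, hy, hyw⟩, -⟩ := hw.resolve_left hw'
    obtain ⟨T', hT'⟩ := hT.exists_insert_of_adj_adj (mt (hmem z).1 (by tauto)) hwT hy hyw hwz
      hz_adj
    exact hzX (hmax z T' hT')
  refine ⟨X, setNbhd G X, setNbhd G (setNbhd G X) \ X, T,
    ⟨Set.eq_univ_of_forall hcover, hXY, Set.disjoint_sdiff_right,
      Set.disjoint_left.2 fun y hy hy' ↦ hy'.1.1 hy, rfl, rfl, hT.verts_eq,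
      hT.isSubtree.coe_isTree, hT.adj_of_adj⟩, fun y hy ↦ ?_, ?_⟩
  · by_contra! h
    obtain ⟨T', hT'⟩ := hT.exists_insert_of_mem_setNbhd hy h
    exact hy.1 (hmax y T' hT')
  · rintro z ⟨⟨hzY, y, hy, hyz⟩, hzX⟩
    by_contra! h
    obtain ⟨T', hT'⟩ := hT.exists_insert_of_unique_adj (mt (hmem z).1 (by tauto)) hy hyz
      fun u hu hzu ↦ by_contra fun hne ↦ h u hu y hy hne hzu hyz.symm
    exact hzX (hmax z T' hT')
end

section
/- Let G be a finite simple graph and let S and W be disjoint sets of edges of G such that every vertex of G is incident to at least one edge of S ∪ W. Then the following are equivalent: (i) there exist a port numbering π of G and an orientation of S (a choice of exactly one dart for each edge of S) such that the set H of darts consisting of both darts of every edge of W together with the chosen darts of the edges of S is closed under the RH-successor map determined by π; (ii) every vertex of G is incident to an even number of edges of S, and every vertex incident to no edge of S is saturated by W, i.e., every edge of G incident to such a vertex belongs to W. -/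
/-- `b` is the RH-successor of the dart `a`: `b` starts at the head of `a` and leaves
it through the cyclic successor of the port through which `a` entered. -/
def RHSucc {V : Type*} (G : SimpleGraph V) (π : V → V → ℕ) (a b : G.Dart) : Prop :=
  b.fst = a.snd ∧ π a.snd b.snd = π a.snd a.fst % portDeg G a.snd + 1

open Finset in
/-- A symmetric `ZMod 2`-valued function with zero diagonal and zero row sums (the adjacency
matrix of a graph with even degrees) lifts to an antisymmetric integer function with values in
`{-1, 0, 1}` and zero row sums (a balanced orientation of the graph). -/
theorem exists_balanced_orientation {V : Type*} [Fintype V] (g : V → V → ZMod 2)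
    (hsymm : ∀ x y, g x y = g y x) (hdiag : ∀ x, g x x = 0) (hsum : ∀ x, ∑ y, g x y = 0) :
    ∃ f : V → V → ℤ, (∀ x y, f x y = -f y x) ∧ (∀ x y, f x y = -1 ∨ f x y = 0 ∨ f x y = 1) ∧
      (∀ x y, (f x y : ZMod 2) = g x y) ∧ ∀ x, ∑ y, f x y = 0 := by
  classical
  induction hn : #{p : V × V | g p.1 p.2 ≠ 0} using Nat.strong_induction_on generalizing g with
  | _ n ih =>
  by_cases h0 : ∀ x y, g x y = 0
  · exact ⟨fun _ _ => 0, by simp [h0]⟩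
  push Not at h0
  obtain ⟨v, a, hva⟩ := h0
  obtain ⟨b, hba, hvb⟩ : ∃ b, b ≠ a ∧ g v b ≠ 0 := by
    by_contra! hcon
    have := hsum v
    rw [Finset.sum_eq_single a (fun b _ hb => hcon b hb) (by simp)] at this
    exact hva this
  have hav : a ≠ v := by rintro rfl; exact hva (hdiag _)
  have hbv : b ≠ v := by rintro rfl; exact hvb (hdiag _)
  have one_of_ne : ∀ z : ZMod 2, z ≠ 0 → z = 1 := by decide
  have hva1 := one_of_ne _ hva
  have hvb1 := one_of_ne _ hvb
  let e (p q x y : V) : ℤ :=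
    (if x = p then if y = q then 1 else 0 else 0) - (if x = q then if y = p then 1 else 0 else 0)
  have hesum : ∀ p q x, ∑ y, e p q x y = (if x = p then 1 else 0) - (if x = q then 1 else 0) := by
    intro p q x
    simp only [e, Finset.sum_sub_distrib]
    congr 1 <;> split_ifs <;> simp
  obtain ⟨t, ht⟩ : ∃ t : V → V → ℤ, t = fun x y => e a v x y + e v b x y + e b a x y := ⟨_, rfl⟩
  have htsum : ∀ x, ∑ y, t x y = 0 := by
    intro x
    simp only [ht, Finset.sum_add_distrib, hesum]
    ring
  have htanti : ∀ x y, t x y = -t y x := by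
    intro x y
    simp only [ht, e]
    grind
  have htav : t a v = 1 := by simp [ht, e, hav, hbv.symm, hba.symm]
  have htvb : t v b = 1 := by simp [ht, e, hav.symm, hbv.symm, hba]
  have htba : t b a = 1 := by simp [ht, e, hav, hbv, hba]
  have htoff : ∀ x y, t x y = 0 ∨ (x = a ∧ y = v) ∨ (x = v ∧ y = a) ∨ (x = v ∧ y = b) ∨
      (x = b ∧ y = v) ∨ (x = b ∧ y = a) ∨ (x = a ∧ y = b) := by
    intro x y
    simp only [ht, e]
    grind
  have neg_eq : ∀ z : ZMod 2, -z = z := by decide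
  have add_self : (1 : ZMod 2) + 1 = 0 := by decide
  have htsymm : ∀ x y, (t x y : ZMod 2) = t y x := by
    intro x y
    rw [htanti x y, Int.cast_neg, neg_eq]
  have h'av : g a v + (t a v : ZMod 2) = 0 := by rw [hsymm, hva1, htav]; simpa using add_self
  have h'vb : g v b + (t v b : ZMod 2) = 0 := by rw [hvb1, htvb]; simpa using add_self
  obtain ⟨f, hfanti, hfval, hfg, hfsum⟩ := ih
    #{p : V × V | g p.1 p.2 + (t p.1 p.2 : ZMod 2) ≠ 0} (by
      have hsub : ({p : V × V | g p.1 p.2 + (t p.1 p.2 : ZMod 2) ≠ 0} : Finset (V × V)) ⊆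
          (({p : V × V | g p.1 p.2 ≠ 0} : Finset (V × V)) \
            {(a, v), (v, a), (v, b), (b, v)}) ∪ {(a, b), (b, a)} := by
        rintro ⟨x, y⟩ hxy
        simp only [mem_filter, mem_univ, true_and] at hxy
        have h'va : g v a + (t v a : ZMod 2) = 0 := by rw [hsymm, htsymm]; exact h'av
        have h'bv : g b v + (t b v : ZMod 2) = 0 := by rw [hsymm, htsymm]; exact h'vb
        simp only [mem_union, mem_sdiff, mem_filter, mem_univ, true_and, mem_insert,
          mem_singleton, Prod.mk.injEq]
        rcases htoff x y with h | ⟨rfl, rfl⟩ | ⟨rfl, rfl⟩ | ⟨rfl, rfl⟩ | ⟨rfl, rfl⟩ |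
          ⟨rfl, rfl⟩ | ⟨rfl, rfl⟩
        · left
          rw [h] at hxy
          refine ⟨by simpa using hxy, ?_⟩
          rintro (⟨rfl, rfl⟩ | ⟨rfl, rfl⟩ | ⟨rfl, rfl⟩ | ⟨rfl, rfl⟩)
          · omega
          · have := htanti x y; omega
          · omega
          · have := htanti x y; omega
        all_goals first | contradiction | simp
      have hsub' : ({(a, v), (v, a), (v, b), (b, v)} : Finset (V × V)) ⊆
          ({p : V × V | g p.1 p.2 ≠ 0} : Finset (V × V)) := by
        intro p hp
        simp only [mem_insert, mem_singleton] at hp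
        simp only [mem_filter, mem_univ, true_and]
        rcases hp with rfl | rfl | rfl | rfl
        · rwa [hsymm]
        · exact hva
        · exact hvb
        · rwa [hsymm]
      have h4 : #({(a, v), (v, a), (v, b), (b, v)} : Finset (V × V)) = 4 := by
        rw [card_insert_of_notMem, card_insert_of_notMem, card_insert_of_notMem, card_singleton] <;>
          simp [hav, hav.symm, hbv, hbv.symm, hba.symm]
      have h2 : #({(a, b), (b, a)} : Finset (V × V)) ≤ 2 := card_le_two
      have h1 := card_le_card hsub
      have h3 := card_union_le ((({p : V × V | g p.1 p.2 ≠ 0} : Finset (V × V)) \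
            {(a, v), (v, a), (v, b), (b, v)})) {(a, b), (b, a)}
      have h5 := card_sdiff_of_subset hsub'
      have h6 := card_le_card hsub'
      omega)
    (fun x y => g x y + (t x y : ZMod 2))
    (by intro x y; simp only [hsymm x y, htsymm x y])
    (by
      intro x
      have : t x x = 0 := by have := htanti x x; omega
      simp [hdiag, this])
    (by
      intro x
      rw [Finset.sum_add_distrib, hsum, ← Int.cast_sum, htsum]
      simp)
    rfl
  have hf0 : ∀ x y, g x y + (t x y : ZMod 2) = 0 → f x y = 0 := by
    intro x y h
    rw [← hfg] at h
    rcases hfval x y with h' | h' | h'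
    · rw [h'] at h; exact absurd h (by decide)
    · exact h'
    · rw [h'] at h; exact absurd h (by decide)
  have hfav := hf0 _ _ h'av
  have hfvb := hf0 _ _ h'vb
  obtain ⟨s, hs1, hs⟩ : ∃ s : ℤ, (s = 1 ∨ s = -1) ∧ (f a b = 0 ∨ f a b = s) := by
    rcases hfval a b with h | h | h
    · exact ⟨-1, by simp, by simp [h]⟩
    · exact ⟨1, by simp, by simp [h]⟩
    · exact ⟨1, by simp, by simp [h]⟩
  have hscast : (s : ZMod 2) = 1 := by
    rcases hs1 with rfl | rfl <;> decide
  refine ⟨fun x y => f x y + s * t x y, ?_, ?_, ?_, ?_⟩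
  · intro x y
    simp only [hfanti x y, htanti x y]
    ring
  · intro x y
    have e1 := hfanti x y
    have e2 := htanti x y
    simp only
    rcases htoff x y with h | ⟨rfl, rfl⟩ | ⟨rfl, rfl⟩ | ⟨rfl, rfl⟩ | ⟨rfl, rfl⟩ |
      ⟨rfl, rfl⟩ | ⟨rfl, rfl⟩
    · rw [h]; simpa using hfval x y
    all_goals
      rcases hs1 with rfl | rfl <;> grind
  · intro x y
    push_cast
    rw [hfg, hscast, one_mul, add_assoc, ← two_mul, show (2 : ZMod 2) = 0 from rfl]
    simp
  · intro x
    rw [Finset.sum_add_distrib, ← Finset.mul_sum, hfsum, htsum]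
    simp

open Finset in
/-- A `{-1, 0, 1}`-valued function with zero sum takes the values
`1` and `-1` equally often. -/
theorem card_eq_one_eq_card_eq_neg_one {V : Type*} [Fintype V] (f : V → ℤ)
    (hval : ∀ y, f y = -1 ∨ f y = 0 ∨ f y = 1) (hsum : ∑ y, f y = 0) :
    #{y | f y = 1} = #{y | f y = -1} := by
  have h : ∀ y, f y = (if f y = 1 then 1 else 0) - (if f y = -1 then 1 else 0) := by
    intro y
    rcases hval y with h | h | h <;> simp [h]
  rw [Finset.sum_congr rfl fun y _ => h y, Finset.sum_sub_distrib, Finset.sum_boole,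
    Finset.sum_boole] at hsum
  exact_mod_cast sub_eq_zero.mp hsum

/-- If the last elements of two lists satisfy a predicate, so does that of their concatenation. -/
theorem forall_mem_getLast?_append {α : Type*} {p : α → Prop} {l₁ l₂ : List α}
    (h₁ : ∀ x ∈ l₁.getLast?, p x) (h₂ : ∀ x ∈ l₂.getLast?, p x) :
    ∀ x ∈ (l₁ ++ l₂).getLast?, p x := by
  intro x hx
  rw [List.getLast?_append, Option.mem_def, Option.or_eq_some_iff] at hx
  rcases hx with hx | hx
  · exact h₂ x hx
  · exact h₁ x hx.2

/-- Two lists of the same length can be merged alternatingly. -/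
theorem exists_alternating_list {α : Type*} (P Q : α → Prop) (l₁ l₂ : List α)
    (hlen : l₁.length = l₂.length) (hQ : ∀ x ∈ l₂, Q x ∧ ¬ P x) :
    ∃ l : List α, (l : Multiset α) = l₁ + l₂ ∧ l.IsChain (fun x y => P x → Q y) ∧
      ∀ x ∈ l.getLast?, ¬ P x := by
  induction l₁ generalizing l₂ with
  | nil =>
    obtain rfl : l₂ = [] := by simpa using hlen.symm
    exact ⟨[], by simp⟩
  | cons u l₁ ih =>
    obtain _ | ⟨w, l₂⟩ := l₂
    · simp at hlen
    obtain ⟨l, hl, hc, hlast⟩ := ih l₂ (by simpa using hlen) fun x hx => hQ x (by simp [hx])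
    have hw := hQ w (by simp)
    refine ⟨[u, w] ++ l, ?_, ?_, ?_⟩
    · have : (([u, w] ++ l : List α) : Multiset α) = u ::ₘ w ::ₘ (l : Multiset α) := rfl
      rw [this, hl, ← Multiset.cons_coe, ← Multiset.cons_coe]
      simp only [← Multiset.singleton_add]
      abel
    · rw [List.isChain_append]
      refine ⟨by simp [hw.1], hc, ?_⟩
      simp [hw.2]
    · exact forall_mem_getLast?_append (by simp [hw.2]) hlast

open Finset in
/-- A finite set can be listed so that every element satisfying `P` is cyclically followed by an
element satisfying `Q`, as soon as `P` and `Q` have the same number of solutions in it and either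
all its elements satisfy `Q` or some element satisfies `P` but not `Q`. -/
theorem exists_cyclic_list {α : Type*} [DecidableEq α] (N : Finset α) (P Q : α → Prop)
    [DecidablePred P] [DecidablePred Q]
    (hcard : #{x ∈ N | P x ∧ ¬ Q x} = #{x ∈ N | Q x ∧ ¬ P x})
    (hN : (∀ x ∈ N, Q x) ∨ ∃ x ∈ N, P x ∧ ¬ Q x) :
    ∃ l : List α, (l : Multiset α) = N.val ∧ l.IsChain (fun x y => P x → Q y) ∧
      ∀ x ∈ l.getLast?, ∀ y ∈ l.head?, P x → Q y := by
  rcases hN with hN | ⟨u, huN, hu⟩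
  · refine ⟨N.toList, by simp, ?_, ?_⟩
    · rw [List.isChain_iff_getElem]
      intro i hi _
      exact hN _ (Finset.mem_toList.mp (List.getElem_mem _))
    · intro x _ y hy _
      exact hN _ (Finset.mem_toList.mp (List.mem_of_mem_head? hy))
  have huA : u ∈ ({x ∈ N | P x ∧ ¬ Q x} : Finset α) := by simp [huN, hu]
  obtain ⟨w, hwB⟩ : ({x ∈ N | Q x ∧ ¬ P x} : Finset α).Nonempty := by
    rw [← Finset.card_pos, ← hcard]
    exact Finset.card_pos.mpr ⟨u, huA⟩
  have hw : w ∈ N ∧ Q w ∧ ¬ P w := by simpa using hwB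
  obtain ⟨l, hl, hc, hlast⟩ := exists_alternating_list P Q
    (({x ∈ N | P x ∧ ¬ Q x} : Finset α).erase u).toList
    (({x ∈ N | Q x ∧ ¬ P x} : Finset α).erase w).toList
    (by simp [Finset.card_erase_of_mem huA, Finset.card_erase_of_mem hwB, hcard])
    (by simp +contextual)
  obtain ⟨X, hX⟩ : ∃ X : List α, X = ({x ∈ N | P x ∧ Q x} : Finset α).toList := ⟨_, rfl⟩
  obtain ⟨Y, hY⟩ : ∃ Y : List α, Y = ({x ∈ N | ¬ P x ∧ ¬ Q x} : Finset α).toList := ⟨_, rfl⟩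
  have hXQ : ∀ x ∈ X, Q x := by simp +contextual [hX]
  have hYP : ∀ x ∈ Y, ¬ P x := by simp +contextual [hY]
  have hYl : (Y ++ l).IsChain (fun x y => P x → Q y) := by
    rw [List.isChain_append]
    refine ⟨?_, hc, ?_⟩
    · rw [List.isChain_iff_getElem]
      intro i hi h
      exact absurd h (hYP _ (List.getElem_mem _))
    · intro x hx y _ h
      exact absurd h (hYP _ (List.mem_of_getLast? hx))
  have huX : (u :: (X ++ [w])).IsChain (fun x y => P x → Q y) := by
    rw [List.isChain_iff_getElem]
    intro i hi _
    have : (u :: (X ++ [w]))[i + 1] ∈ X ++ [w] := by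
      rw [List.getElem_cons_succ]
      exact List.getElem_mem _
    rcases List.mem_append.mp this with h | h
    · exact hXQ _ h
    · rw [List.mem_singleton.mp h]
      exact hw.2.1
  have huXlast : ∀ x ∈ (u :: (X ++ [w])).getLast?, ¬ P x := by
    intro x hx
    rw [← List.cons_append, List.getLast?_concat, Option.mem_def, Option.some_inj] at hx
    exact hx ▸ hw.2.2
  refine ⟨(u :: (X ++ [w])) ++ (Y ++ l), ?_, ?_, ?_⟩
  · have hm : (((u :: (X ++ [w])) ++ (Y ++ l) : List α) : Multiset α) =
        {u} + (X + {w}) + (Y + (l : Multiset α)) := rfl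
    rw [hm, hl, hX, hY]
    simp only [Finset.coe_toList]
    have e1 : ({u} : Multiset α) + (({x ∈ N | P x ∧ ¬ Q x} : Finset α).erase u).val =
        ({x ∈ N | P x ∧ ¬ Q x} : Finset α).val := by
      rw [Finset.erase_val, Multiset.singleton_add, Multiset.cons_erase huA]
    have e2 : ({w} : Multiset α) + (({x ∈ N | Q x ∧ ¬ P x} : Finset α).erase w).val =
        ({x ∈ N | Q x ∧ ¬ P x} : Finset α).val := by
      rw [Finset.erase_val, Multiset.singleton_add, Multiset.cons_erase hwB]
    have e3 : ({u} : Multiset α) + (({x ∈ N | P x ∧ Q x} : Finset α).val + {w}) +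
        (({x ∈ N | ¬ P x ∧ ¬ Q x} : Finset α).val +
          ((({x ∈ N | P x ∧ ¬ Q x} : Finset α).erase u).val +
            (({x ∈ N | Q x ∧ ¬ P x} : Finset α).erase w).val)) =
        ({u} + (({x ∈ N | P x ∧ ¬ Q x} : Finset α).erase u).val) +
          ({w} + (({x ∈ N | Q x ∧ ¬ P x} : Finset α).erase w).val) +
          ({x ∈ N | P x ∧ Q x} : Finset α).val + ({x ∈ N | ¬ P x ∧ ¬ Q x} : Finset α).val := by
      abel
    rw [e3, e1, e2]
    ext x
    simp only [Multiset.count_add, Finset.filter_val, Multiset.count_filter]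
    by_cases hP : P x <;> by_cases hQ : Q x <;> simp [hP, hQ]
  · rw [List.isChain_append]
    refine ⟨huX, hYl, ?_⟩
    intro x hx y _ h
    exact absurd h (huXlast x hx)
  · intro x hx y _ h
    exact absurd h (forall_mem_getLast?_append huXlast (forall_mem_getLast?_append
      (fun z hz => hYP z (List.mem_of_getLast? hz)) hlast) x hx)

open Finset in
/-- A finite set can be numbered so that every element satisfying `P` is cyclically followed by an
element satisfying `Q`, under the assumptions of `exists_cyclic_list`. -/
theorem exists_cyclic_numbering {α : Type*} (N : Finset α) (P Q : α → Prop)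
    [DecidablePred P] [DecidablePred Q]
    (hcard : #{x ∈ N | P x ∧ ¬ Q x} = #{x ∈ N | Q x ∧ ¬ P x})
    (hN : (∀ x ∈ N, Q x) ∨ ∃ x ∈ N, P x ∧ ¬ Q x) :
    ∃ p : α → ℕ, Set.BijOn p N (Set.Icc 1 #N) ∧
      ∀ x ∈ N, ∀ y ∈ N, P x → p y = p x % #N + 1 → Q y := by
  classical
  obtain ⟨l, hl, hc, hlast⟩ := exists_cyclic_list N P Q hcard hN
  have hmem : ∀ x, x ∈ l ↔ x ∈ N := fun x => by
    rw [← Finset.mem_val, ← hl, Multiset.mem_coe]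
  have hlen : l.length = #N := by
    rw [Finset.card_def, ← hl, Multiset.coe_card]
  have hnd : l.Nodup := by
    rw [← Multiset.coe_nodup, hl]
    exact N.nodup
  refine ⟨fun x => l.idxOf x + 1, ⟨?_, ?_, ?_⟩, ?_⟩
  · intro x hx
    have := List.idxOf_lt_length_of_mem ((hmem x).mpr hx)
    simp only [Set.mem_Icc]
    omega
  · intro x hx y hy hxy
    exact (List.idxOf_inj ((hmem x).mpr hx)).mp (by simpa using hxy)
  · rintro i ⟨hi1, hi2⟩
    have hi : i - 1 < l.length := by omega
    refine ⟨l[i - 1], (hmem _).mp (List.getElem_mem _), ?_⟩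
    simp only [hnd.idxOf_getElem]
    omega
  · intro x hx y hy hP hxy
    have hxl := List.idxOf_lt_length_of_mem ((hmem x).mpr hx)
    have hyl := List.idxOf_lt_length_of_mem ((hmem y).mpr hy)
    have hgx : l[l.idxOf x] = x := List.getElem_idxOf hxl
    have hgy : l[l.idxOf y] = y := List.getElem_idxOf hyl
    simp only [← hlen, Nat.add_right_cancel_iff] at hxy
    by_cases hlt : l.idxOf x + 1 < l.length
    · rw [Nat.mod_eq_of_lt hlt] at hxy
      have := List.isChain_iff_getElem.mp hc (l.idxOf x) hlt
      simp only [hgx, ← hxy, hgy] at this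
      exact this hP
    · have heq : l.idxOf x + 1 = l.length := by omega
      rw [heq, Nat.mod_self] at hxy
      refine hlast x ?_ y ?_ hP
      · rw [List.getLast?_eq_getElem?, ← heq, Nat.add_sub_cancel, Option.mem_def,
          List.getElem?_eq_getElem hxl, hgx]
      · rw [List.head?_eq_getElem?, ← hxy, Option.mem_def, List.getElem?_eq_getElem hyl, hgy]

open Finset in
/-- If in a cyclic numbering every element satisfying `P` is followed by one satisfying `Q`, then
at most as many elements satisfy `P` as satisfy `Q`. -/
theorem card_filter_le_of_cyclic_numbering {α : Type*} (N : Finset α) (P Q : α → Prop)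
    [DecidablePred P] [DecidablePred Q] (p : α → ℕ) (hp : Set.BijOn p N (Set.Icc 1 #N))
    (hPQ : ∀ x ∈ N, ∀ y ∈ N, P x → p y = p x % #N + 1 → Q y) :
    #{x ∈ N | P x} ≤ #{x ∈ N | Q x} := by
  have hsucc : ∀ x ∈ N, ∃ y ∈ N, p y = p x % #N + 1 := by
    intro x hx
    have hpos : 0 < #N := Finset.card_pos.mpr ⟨x, hx⟩
    have := Nat.mod_lt (p x) hpos
    obtain ⟨y, hy, h⟩ := hp.surjOn (show p x % #N + 1 ∈ Set.Icc 1 #N from ⟨by omega, by omega⟩)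
    exact ⟨y, hy, h⟩
  choose! s hsN hs using hsucc
  refine Finset.card_le_card_of_injOn s ?_ ?_
  · intro x hx
    simp only [Finset.coe_filter, Set.mem_ofPred_eq] at hx ⊢
    exact ⟨hsN x hx.1, hPQ x hx.1 _ (hsN x hx.1) hx.2 (hs x hx.1)⟩
  · intro x hx y hy hxy
    simp only [Finset.coe_filter, Set.mem_ofPred_eq] at hx hy
    have h1 := hs x hx.1
    rw [hxy, hs y hy.1, Nat.add_right_cancel_iff] at h1
    obtain ⟨hx1, hx2⟩ := hp.mapsTo hx.1
    obtain ⟨hy1, hy2⟩ := hp.mapsTo hy.1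
    refine hp.injOn hx.1 hy.1 ?_
    rcases hx2.eq_or_lt with hx2 | hx2 <;> rcases hy2.eq_or_lt with hy2 | hy2
    · omega
    · rw [hx2, Nat.mod_self, Nat.mod_eq_of_lt hy2] at h1
      omega
    · rw [hy2, Nat.mod_self, Nat.mod_eq_of_lt hx2] at h1
      omega
    · rw [Nat.mod_eq_of_lt hx2, Nat.mod_eq_of_lt hy2] at h1
      omega

open Finset in
/-- A property that holds somewhere and passes to cyclic successors holds everywhere. -/
theorem forall_of_cyclic_numbering {α : Type*} (N : Finset α) (P : α → Prop)
    (p : α → ℕ) (hp : Set.BijOn p N (Set.Icc 1 #N))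
    (hP : ∀ x ∈ N, ∀ y ∈ N, P x → p y = p x % #N + 1 → P y) (hex : ∃ x ∈ N, P x) :
    ∀ x ∈ N, P x := by
  obtain ⟨x₀, hx₀, hPx₀⟩ := hex
  have up : ∀ x ∈ N, P x → ∀ j, p x ≤ j → j ≤ #N → ∀ y ∈ N, p y = j → P y := by
    intro x hx hPx j hj
    induction j, hj using Nat.le_induction with
    | base =>
      intro _ y hy hxy
      rwa [hp.injOn hy hx hxy]
    | succ j hj ih =>
      intro hjN y hy hyj
      obtain ⟨hx1, -⟩ := hp.mapsTo hx
      obtain ⟨z, hz, hzj⟩ := hp.surjOn (show j ∈ Set.Icc 1 #N from ⟨by omega, by omega⟩)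
      refine hP z hz y hy (ih (by omega) z hz hzj) ?_
      rw [hzj, Nat.mod_eq_of_lt (by omega), hyj]
  have hpos : 0 < #N := Finset.card_pos.mpr ⟨x₀, hx₀⟩
  obtain ⟨z, hz, hzN⟩ := hp.surjOn (show #N ∈ Set.Icc 1 #N from ⟨hpos, le_rfl⟩)
  obtain ⟨o, ho, ho1⟩ := hp.surjOn (show 1 ∈ Set.Icc 1 #N from ⟨le_rfl, hpos⟩)
  have hPz := up x₀ hx₀ hPx₀ #N (hp.mapsTo hx₀).2 le_rfl z hz hzN
  have hPo := hP z hz o ho hPz (by rw [ho1, hzN, Nat.mod_self])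
  intro x hx
  exact up o ho hPo (p x) (ho1 ▸ (hp.mapsTo hx).1) (hp.mapsTo hx).2 x hx rfl

open Finset in
/-- The edges of `S` at `v` correspond to the vertices joined to `v` by an edge of `S`. -/
theorem ncard_incident_eq_card {V : Type*} [Fintype V] (S : Set (Sym2 V)) (v : V)
    [DecidablePred fun y => s(v, y) ∈ S] :
    {e ∈ S | v ∈ e}.ncard = #{y | s(v, y) ∈ S} := by
  have h : {e ∈ S | v ∈ e} = Set.image (fun y => s(v, y)) {y | s(v, y) ∈ S} := by
    ext e
    constructor
    · rintro ⟨he, y, rfl⟩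
      exact ⟨y, he, rfl⟩
    · rintro ⟨y, hy, rfl⟩
      exact ⟨hy, Sym2.mem_mk_left v y⟩
  rw [h, Set.ncard_image_of_injective _ (fun y z hyz => Sym2.congr_right.mp hyz),
    ← Set.ncard_coe_finset]
  simp

open Finset in
/-- Characterization of unions of RH-cycles. Given disjoint edge sets `S` and `W`
covering all vertices, there is a port numbering and an orientation of `S` (a set `C`
of darts containing exactly one dart of each edge of `S`) such that the dart set
consisting of both darts of every edge of `W` together with `C` is closed under the
RH-successor map, if and only if every vertex is incident to an even number of edges
of `S`, and every vertex incident to no edge of `S` is saturated by `W`. -/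
theorem union_of_RH_cycles_iff {V : Type*} [Fintype V] (G : SimpleGraph V)
    (S W : Set (Sym2 V)) (hS : S ⊆ G.edgeSet) (hW : W ⊆ G.edgeSet)
    (hSW : Disjoint S W) (hcov : ∀ v : V, ∃ e ∈ S ∪ W, v ∈ e) :
    (∃ π : V → V → ℕ, IsPortNumbering G π ∧
        ∃ C : Set G.Dart,
          (∀ d ∈ C, d.edge ∈ S) ∧
          (∀ e ∈ S, ∃! d : G.Dart, d ∈ C ∧ d.edge = e) ∧
          (∀ a ∈ {d : G.Dart | d.edge ∈ W} ∪ C, ∀ b : G.Dart,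
            RHSucc G π a b → b ∈ {d : G.Dart | d.edge ∈ W} ∪ C)) ↔
      (∀ v : V, Even {e ∈ S | v ∈ e}.ncard ∧
        ({e ∈ S | v ∈ e} = ∅ → ∀ e ∈ G.edgeSet, v ∈ e → e ∈ W)) := by
  classical
  have hN : ∀ v, #{u | G.Adj v u} = portDeg G v := by
    intro v
    rw [portDeg, ← Set.ncard_coe_finset]
    congr 1
    ext u
    simp
  have hNset : ∀ v, (({u | G.Adj v u} : Finset V) : Set V) = G.neighborSet v := by
    intro v
    ext u
    simp
  have hnotW : ∀ e ∈ S, e ∉ W := fun e h h' => Set.disjoint_left.mp hSW h h'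
  constructor
  · rintro ⟨π, hπ, C, hCS, hC, hclosed⟩
    obtain ⟨c, hc⟩ : ∃ c : V → V → Prop, c = fun x y => ∃ h : G.Adj x y, (⟨(x, y), h⟩ : G.Dart) ∈ C :=
      ⟨_, rfl⟩
    have hcS : ∀ x y, c x y → s(x, y) ∈ S := by
      intro x y hxy
      rw [hc] at hxy
      obtain ⟨h, hd⟩ := hxy
      exact hCS _ hd
    have hSc : ∀ x y, s(x, y) ∈ S → c x y ∨ c y x := by
      intro x y hxy
      obtain ⟨d, ⟨hd, hde⟩, -⟩ := hC _ hxy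
      rw [hc]
      obtain ⟨⟨p, q⟩, hpq⟩ := d
      have : s(p, q) = s(x, y) := hde
      rcases Sym2.eq_iff.mp this with ⟨rfl, rfl⟩ | ⟨rfl, rfl⟩
      · exact Or.inl ⟨hpq, hd⟩
      · exact Or.inr ⟨hpq, hd⟩
    have hcc : ∀ x y, c x y → ¬ c y x := by
      intro x y h1 h2
      have hS' := hcS x y h1
      rw [hc] at h1 h2
      obtain ⟨a1, d1⟩ := h1
      obtain ⟨a2, d2⟩ := h2
      have := (hC _ hS').unique ⟨d1, rfl⟩ ⟨d2, Sym2.eq_swap⟩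
      simp only [SimpleGraph.Dart.mk.injEq, Prod.mk.injEq] at this
      exact a1.ne this.1
    have hloc : ∀ v, ∀ x ∈ ({u | G.Adj v u} : Finset V), ∀ y ∈ ({u | G.Adj v u} : Finset V),
        (s(x, v) ∈ W ∨ c x v) → π v y = π v x % #{u | G.Adj v u} + 1 →
          (s(v, y) ∈ W ∨ c v y) := by
      intro v x hx y hy hxv hsucc
      simp only [Finset.mem_filter, Finset.mem_univ, true_and] at hx hy
      have := hclosed ⟨(x, v), hx.symm⟩ (by
        rcases hxv with h | h
        · exact Or.inl h
        · rw [hc] at h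
          exact Or.inr h.2) ⟨(v, y), hy⟩ ⟨rfl, by rw [← hN]; exact hsucc⟩
      rcases this with h | h
      · exact Or.inl h
      · exact Or.inr (by rw [hc]; exact ⟨hy, h⟩)
    have hbij : ∀ v, Set.BijOn (π v) (({u | G.Adj v u} : Finset V) : Set V)
        (Set.Icc 1 #{u | G.Adj v u}) := by
      intro v
      rw [hNset, hN]
      exact hπ v
    have hsplit : ∀ (v : V) (r : V → Prop), (∀ u, r u → s(v, u) ∈ S) →
        #{u ∈ ({u | G.Adj v u} : Finset V) | s(v, u) ∈ W ∨ r u} =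
          #{u | s(v, u) ∈ W} + #{u | r u} := by
      intro v r hr
      rw [← Finset.card_union_of_disjoint]
      · congr 1
        ext u
        simp only [Finset.mem_filter, Finset.mem_univ, true_and, Finset.mem_union]
        refine ⟨fun h => h.2, fun h => ⟨?_, h⟩⟩
        rcases h with h | h
        · exact hW h
        · exact hS (hr u h)
      · rw [Finset.disjoint_filter]
        exact fun u _ h h' => hnotW _ (hr u h') h
    have hle : ∀ v, #{u | c u v} ≤ #{u | c v u} := by
      intro v
      have := card_filter_le_of_cyclic_numbering _ _ _ (π v) (hbij v) (hloc v)
      simp only [Sym2.eq_swap (b := v)] at this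
      rw [hsplit v _ fun u h => by rw [Sym2.eq_swap]; exact hcS _ _ h,
        hsplit v _ fun u h => hcS _ _ h] at this
      omega
    have hsum : ∑ v, #{u | c u v} = ∑ v, #{u | c v u} := by
      simp only [Finset.card_filter]
      exact Finset.sum_comm
    have heq : ∀ v, #{u | c u v} = #{u | c v u} := fun v =>
      (Finset.sum_eq_sum_iff_of_le fun v _ => hle v).mp hsum v (Finset.mem_univ v)
    intro v
    constructor
    · rw [ncard_incident_eq_card]
      have : ({y | s(v, y) ∈ S} : Finset V) =
          ({u | c u v} : Finset V) ∪ ({u | c v u} : Finset V) := by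
        ext u
        simp only [Finset.mem_filter, Finset.mem_univ, true_and, Finset.mem_union]
        refine ⟨fun h => (hSc _ _ h).symm, ?_⟩
        rintro (h | h)
        · rw [Sym2.eq_swap]; exact hcS _ _ h
        · exact hcS _ _ h
      rw [this, Finset.card_union_of_disjoint, heq]
      · exact ⟨_, rfl⟩
      · rw [Finset.disjoint_filter]
        exact fun u _ h => hcc _ _ h
    · intro hempty e he hve
      have hnS : ∀ u, s(v, u) ∉ S := by
        intro u hu
        have : s(v, u) ∈ {e ∈ S | v ∈ e} := ⟨hu, Sym2.mem_mk_left v u⟩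
        rw [hempty] at this
        exact this
      obtain ⟨y, rfl⟩ := hve
      refine forall_of_cyclic_numbering _ (fun u => s(v, u) ∈ W) (π v) (hbij v) ?_ ?_ y
        (by simpa using he)
      · intro x hx z hz hxW hxz
        rcases hloc v x hx z hz (Or.inl (by rwa [Sym2.eq_swap])) hxz with h | h
        · exact h
        · exact absurd (hcS _ _ h) (hnS z)
      · obtain ⟨e', he', u, rfl⟩ := hcov v
        rcases he' with h | h
        · exact absurd h (hnS u)
        · exact ⟨u, by simpa using hW h, h⟩
  · intro hv
    obtain ⟨f, hfanti, hfval, hfg, hfsum⟩ := exists_balanced_orientation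
      (fun x y => if s(x, y) ∈ S then (1 : ZMod 2) else 0)
      (by intro x y; simp only [Sym2.eq_swap (a := x)])
      (by
        intro x
        rw [if_neg]
        exact fun h => G.loopless.irrefl x (hS h))
      (by
        intro x
        rw [Finset.sum_boole, ← ncard_incident_eq_card]
        exact (ZMod.natCast_eq_zero_iff_even).mpr (hv x).1)
    have hfS : ∀ x y, s(x, y) ∈ S ↔ f x y ≠ 0 := by
      intro x y
      have h := hfg x y
      constructor
      · intro hxy h0
        rw [if_pos hxy, h0] at h
        exact absurd h (by decide)
      · intro h0
        by_contra hxy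
        rw [if_neg hxy] at h
        rcases hfval x y with h1 | h1 | h1
        · rw [h1] at h; exact absurd h (by decide)
        · exact h0 h1
        · rw [h1] at h; exact absurd h (by decide)
    have hlocal : ∀ v, ∃ p : V → ℕ, Set.BijOn p (({u | G.Adj v u} : Finset V) : Set V)
        (Set.Icc 1 #{u | G.Adj v u}) ∧
        ∀ x ∈ ({u | G.Adj v u} : Finset V), ∀ y ∈ ({u | G.Adj v u} : Finset V),
          (s(v, x) ∈ W ∨ f v x = -1) → p y = p x % #{u | G.Adj v u} + 1 →
            (s(v, y) ∈ W ∨ f v y = 1) := by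
      intro v
      have hWf : ∀ u, s(v, u) ∈ W → f v u = 0 := by
        intro u hu
        by_contra h
        exact hnotW _ ((hfS v u).mpr h) hu
      have hadj : ∀ u, f v u ≠ 0 → G.Adj v u := fun u hu => hS ((hfS v u).mpr hu)
      have e1 : ({x ∈ ({u | G.Adj v u} : Finset V) | (s(v, x) ∈ W ∨ f v x = -1) ∧
          ¬ (s(v, x) ∈ W ∨ f v x = 1)} : Finset V) = ({x | f v x = -1} : Finset V) := by
        ext u
        simp only [Finset.mem_filter, Finset.mem_univ, true_and]
        have := hWf u
        have := hadj u
        grind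
      have e2 : ({x ∈ ({u | G.Adj v u} : Finset V) | (s(v, x) ∈ W ∨ f v x = 1) ∧
          ¬ (s(v, x) ∈ W ∨ f v x = -1)} : Finset V) = ({x | f v x = 1} : Finset V) := by
        ext u
        simp only [Finset.mem_filter, Finset.mem_univ, true_and]
        have := hWf u
        have := hadj u
        grind
      have hbal := card_eq_one_eq_card_eq_neg_one (f v) (hfval v) (hfsum v)
      refine exists_cyclic_numbering _ _ _ (by rw [e1, e2, hbal]) ?_
      by_cases hex : ∃ u, f v u = -1
      · obtain ⟨u, hu⟩ := hex
        have : u ∈ ({x | f v x = -1} : Finset V) := by simpa using hu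
        rw [← e1, Finset.mem_filter] at this
        exact Or.inr ⟨u, this⟩
      · left
        intro u hu
        left
        push Not at hex
        have hz : #{y | f v y = 1} = 0 := by
          rw [hbal, Finset.card_eq_zero, Finset.filter_eq_empty_iff]
          exact fun u _ => hex u
        rw [Finset.card_eq_zero, Finset.filter_eq_empty_iff] at hz
        refine (hv v).2 ?_ _ (by simpa using hu) (Sym2.mem_mk_left v u)
        rw [Set.eq_empty_iff_forall_notMem]
        rintro e ⟨he, y, rfl⟩
        have h1 := (hfS v y).mp he
        have h2 := hz (Finset.mem_univ y)
        have h3 := hex y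
        have h4 := hfval v y
        tauto
    choose π hπ hsucc using hlocal
    refine ⟨π, ?_, {d | f d.fst d.snd = 1}, ?_, ?_, ?_⟩
    · intro v
      rw [← hNset, ← hN]
      exact hπ v
    · rintro ⟨⟨x, y⟩, h⟩ hd
      have hd' : f x y = 1 := hd
      exact (hfS x y).mpr (by omega)
    · have key : ∀ x y, s(x, y) ∈ S → f x y = 1 →
          ∃! d : G.Dart, d ∈ {d : G.Dart | f d.fst d.snd = 1} ∧ d.edge = s(x, y) := by
        intro x y he hf
        refine ⟨⟨(x, y), hS he⟩, ⟨hf, rfl⟩, ?_⟩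
        rintro ⟨⟨p, q⟩, hpq⟩ ⟨hd, hde⟩
        have hd' : f p q = 1 := hd
        have hde' : s(p, q) = s(x, y) := hde
        rcases Sym2.eq_iff.mp hde' with ⟨rfl, rfl⟩ | ⟨rfl, rfl⟩
        · rfl
        · have := hfanti p q
          omega
      intro e he
      induction e with | _ x y =>
      rcases hfval x y with h | h | h
      · rw [Sym2.eq_swap] at he ⊢
        exact key y x he (by have := hfanti x y; omega)
      · exact absurd h ((hfS x y).mp he)
      · exact key x y he h
    · rintro ⟨⟨x, v⟩, hxv⟩ ha ⟨⟨v', y⟩, hvy⟩ ⟨hfst, hs⟩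
      obtain rfl : v' = v := hfst
      refine hsucc v' x (by simpa using hxv.symm) y (by simpa using hvy) ?_ (by rw [hN]; exact hs)
      rcases ha with h | h
      · left
        rw [Sym2.eq_swap]
        exact h
      · right
        have h' : f x v' = 1 := h
        have := hfanti x v'
        omega
end

section
/- Let G be a finite connected simple graph with a port numbering π, and let H be a set of darts of G that is closed under the RH-successor map (so the RH-successor map restricts to a permutation P of H) and is two-way connected: every vertex of G is the head of some dart of H, and for any two vertices of G there is a path in G all of whose edges have both of their darts in H. Call two darts of H cycle-equivalent if one is obtained from the other by iterating P, and say that a cycle-class C visits a vertex v if some dart of C has head v. Let C* be a cycle-class of P such that: (a) no vertex visited by C* is visited by three or more distinct cycle-classes, and (b) no cycle-class other than C* contains two distinct darts with the same head v for some vertex v visited by C*. Then C* visits every vertex of G. -/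
/-- Two darts are cycle-equivalent if one is obtained from the other by iterating the
RH-successor map. -/
def CycEq {V : Type*} (G : SimpleGraph V) (π : V → V → ℕ) (a b : G.Dart) : Prop :=
  Relation.ReflTransGen (RHSucc G π) a b ∨ Relation.ReflTransGen (RHSucc G π) b a

/-- Every dart has an RH-successor. -/
theorem IsPortNumbering.exists_rhSucc {V : Type*} [Finite V] {G : SimpleGraph V} {π : V → V → ℕ}
    (hπ : IsPortNumbering G π) (a : G.Dart) : ∃ b, RHSucc G π a b := by
  have hmem : a.fst ∈ G.neighborSet a.snd := a.adj.symm
  have hpos : 0 < portDeg G a.snd := (Set.ncard_pos (Set.toFinite _)).2 ⟨_, hmem⟩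
  obtain ⟨w, hw, hw'⟩ := (hπ a.snd).surjOn
    (show π a.snd a.fst % portDeg G a.snd + 1 ∈ Set.Icc 1 (portDeg G a.snd) from
      ⟨Nat.le_add_left _ _, Nat.mod_lt _ hpos⟩)
  exact ⟨⟨(a.snd, w), hw⟩, rfl, hw'⟩

/-- The RH-successor of a dart is unique. -/
theorem IsPortNumbering.rhSucc_rightUnique {V : Type*} {G : SimpleGraph V} {π : V → V → ℕ}
    (hπ : IsPortNumbering G π) : Relator.RightUnique (RHSucc G π) := by
  rintro a ⟨⟨b₁, b₂⟩, hb⟩ ⟨⟨c₁, c₂⟩, hc⟩ ⟨h₁, h₂⟩ ⟨h₃, h₄⟩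
  dsimp only at h₁ h₂ h₃ h₄
  subst h₁ h₃
  have h := (hπ a.snd).injOn hb hc (h₂.trans h₄.symm)
  subst h
  rfl

/-- A dart is the RH-successor of at most one dart. -/
theorem IsPortNumbering.rhSucc_leftUnique {V : Type*} {G : SimpleGraph V} {π : V → V → ℕ}
    (hπ : IsPortNumbering G π) : Relator.LeftUnique (RHSucc G π) := by
  rintro ⟨⟨a₁, a₂⟩, ha⟩ ⟨⟨c₁, c₂⟩, hc⟩ b ⟨h₁, h₂⟩ ⟨h₃, h₄⟩
  dsimp only at h₁ h₂ h₃ h₄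
  obtain rfl : a₂ = c₂ := h₁.symm.trans h₃
  have hmod : π a₂ a₁ ≡ π a₂ c₁ [MOD portDeg G a₂] := by
    have := h₂.symm.trans h₄
    exact Nat.succ_injective this
  obtain ⟨ha₁, ha₂⟩ := (hπ a₂).mapsTo (show a₁ ∈ G.neighborSet a₂ from ha.symm)
  obtain ⟨hc₁, hc₂⟩ := (hπ a₂).mapsTo (show c₁ ∈ G.neighborSet a₂ from hc.symm)
  have hport : π a₂ a₁ = π a₂ c₁ :=
    hmod.eq_of_abs_lt (by rw [abs_lt]; omega)
  have h := (hπ a₂).injOn (show a₁ ∈ G.neighborSet a₂ from ha.symm) hc.symm hport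
  subst h
  rfl

/-- Reachability along a total, bi-unique relation on a finite type is symmetric. -/
theorem Relation.ReflTransGen.symm_of_biUnique {α : Type*} [Finite α] {r : α → α → Prop}
    (htotal : ∀ a, ∃ b, r a b) (hr : Relator.RightUnique r) (hl : Relator.LeftUnique r)
    {a b : α} (h : Relation.ReflTransGen r a b) : Relation.ReflTransGen r b a := by
  choose f hf using htotal
  have hinj : Function.Injective f := fun x y hxy => hl (hf x) (hxy ▸ hf y)
  have hiter (n : ℕ) (x : α) : Relation.ReflTransGen r x (f^[n] x) := by
    induction n with
    | zero => exact .refl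
    | succ n ih => rw [Function.iterate_succ_apply']; exact ih.tail (hf _)
  induction h with
  | refl => exact .refl
  | @tail b c _ hbc ih =>
    refine Relation.ReflTransGen.trans ?_ ih
    obtain rfl := hr (hf b) hbc
    obtain ⟨n, hn, hper⟩ := hinj.mem_periodicPts b
    obtain ⟨m, rfl⟩ := Nat.exists_eq_succ_of_ne_zero hn.ne'
    have hback := hiter m (f b)
    rwa [← Function.iterate_succ_apply, hper.eq] at hback

/-- Reachability along RH-successors is symmetric. -/
theorem IsPortNumbering.rhSucc_reachable_symm {V : Type*} [Finite V] {G : SimpleGraph V}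
    {π : V → V → ℕ} (hπ : IsPortNumbering G π) {a b : G.Dart}
    (h : Relation.ReflTransGen (RHSucc G π) a b) : Relation.ReflTransGen (RHSucc G π) b a :=
  have : Finite G.Dart := .of_injective _ SimpleGraph.Dart.toProd_injective
  h.symm_of_biUnique hπ.exists_rhSucc hπ.rhSucc_rightUnique hπ.rhSucc_leftUnique

theorem IsPortNumbering.cycEq_iff {V : Type*} [Finite V] {G : SimpleGraph V} {π : V → V → ℕ}
    (hπ : IsPortNumbering G π) {a b : G.Dart} :
    CycEq G π a b ↔ Relation.ReflTransGen (RHSucc G π) a b :=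
  ⟨fun h => h.elim id hπ.rhSucc_reachable_symm, Or.inl⟩

theorem IsPortNumbering.cycEq_equivalence {V : Type*} [Finite V] {G : SimpleGraph V}
    {π : V → V → ℕ} (hπ : IsPortNumbering G π) : Equivalence (CycEq G π) where
  refl _ := .inl .refl
  symm := Or.symm
  trans h₁ h₂ := .inl ((hπ.cycEq_iff.1 h₁).trans (hπ.cycEq_iff.1 h₂))

/-- Every dart is the RH-successor of some dart. -/
theorem IsPortNumbering.exists_rhPred {V : Type*} [Finite V] {G : SimpleGraph V} {π : V → V → ℕ}
    (hπ : IsPortNumbering G π) (b : G.Dart) : ∃ a, RHSucc G π a b := by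
  obtain ⟨c, hc⟩ := hπ.exists_rhSucc b
  rcases (hπ.rhSucc_reachable_symm (.single hc)).cases_tail with h | ⟨a, _, ha⟩
  · exact ⟨b, h ▸ hc⟩
  · exact ⟨a, ha⟩

/-- An RH-closed set of darts is a union of cycle-classes. -/
theorem IsPortNumbering.mem_of_cycEq {V : Type*} [Finite V] {G : SimpleGraph V} {π : V → V → ℕ}
    (hπ : IsPortNumbering G π) {H : Set G.Dart}
    (hclosed : ∀ a ∈ H, ∀ b : G.Dart, RHSucc G π a b → b ∈ H) {a b : G.Dart}
    (h : CycEq G π a b) (ha : a ∈ H) : b ∈ H := by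
  induction hπ.cycEq_iff.1 h with
  | refl => exact ha
  | tail hab hbc ih => exact hclosed _ (ih (.inl hab)) _ hbc

/-- If the RH-successor of a dart is its reversal, then its head is a leaf. -/
theorem IsPortNumbering.eq_fst_of_rhSucc_symm {V : Type*} {G : SimpleGraph V} {π : V → V → ℕ}
    (hπ : IsPortNumbering G π) {a : G.Dart} (h : RHSucc G π a a.symm) {w : V}
    (hw : G.Adj a.snd w) : w = a.fst := by
  have hfst : a.fst ∈ G.neighborSet a.snd := a.adj.symm
  have hport : π a.snd a.fst = π a.snd a.fst % portDeg G a.snd + 1 := h.2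
  have hdeg : portDeg G a.snd = 1 := by
    obtain ⟨h₁, h₂⟩ := (hπ a.snd).mapsTo hfst
    rcases h₂.lt_or_eq with hlt | heq
    · rw [Nat.mod_eq_of_lt hlt] at hport
      omega
    · rw [heq, Nat.mod_self] at hport
      exact hport
  obtain ⟨x, hx⟩ := Set.ncard_eq_one.1 hdeg
  have hw' : w ∈ G.neighborSet a.snd := hw
  rw [hx] at hfst hw'
  exact hw'.trans hfst.symm

/-- If neither Merge3 nor EatSmall applies to the nodes of the cycle-class `C*` of a
two-way connected, RH-closed dart set `H`, then `C*` visits every vertex of `G`. -/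
theorem witness_cycle_of_no_merge3_no_eatsmall {V : Type*} [Fintype V]
    (G : SimpleGraph V) (hconn : G.Connected)
    (π : V → V → ℕ) (hπ : IsPortNumbering G π)
    (H : Set G.Dart)
    (hclosed : ∀ a ∈ H, ∀ b : G.Dart, RHSucc G π a b → b ∈ H)
    (hhead : ∀ v : V, ∃ d ∈ H, d.snd = v)
    (htwoway : ∀ u v : V, ∃ p : G.Walk u v, ∀ d ∈ p.darts, d ∈ H ∧ d.symm ∈ H)
    (Cstar : Set G.Dart) (d₀ : G.Dart) (hd₀ : d₀ ∈ H)
    (hCstar : Cstar = {d ∈ H | CycEq G π d₀ d})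
    (hMerge3 : ∀ v : V, (∃ d ∈ Cstar, d.snd = v) →
      ¬ ∃ d₁ d₂ d₃ : G.Dart, d₁ ∈ H ∧ d₂ ∈ H ∧ d₃ ∈ H ∧
        d₁.snd = v ∧ d₂.snd = v ∧ d₃.snd = v ∧
        ¬ CycEq G π d₁ d₂ ∧ ¬ CycEq G π d₁ d₃ ∧ ¬ CycEq G π d₂ d₃)
    (hEatSmall : ∀ v : V, (∃ d ∈ Cstar, d.snd = v) →
      ¬ ∃ d₁ d₂ : G.Dart, d₁ ∈ H ∧ d₂ ∈ H ∧ d₁ ∉ Cstar ∧ d₁ ≠ d₂ ∧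
        CycEq G π d₁ d₂ ∧ d₁.snd = v ∧ d₂.snd = v) :
    ∀ v : V, ∃ d ∈ Cstar, d.snd = v := by
  have hE := hπ.cycEq_equivalence
  have hstar {d e : G.Dart} (hd : d ∈ Cstar) (hde : CycEq G π d e) : e ∈ Cstar := by
    rw [hCstar] at hd ⊢
    exact ⟨hπ.mem_of_cycEq hclosed hde hd.1, hE.trans hd.2 hde⟩
  have hstarH {d : G.Dart} (hd : d ∈ Cstar) : d ∈ H := by
    rw [hCstar] at hd
    exact hd.1
  by_contra! hmiss
  obtain ⟨v, hv⟩ := hmiss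
  have hd₀star : d₀ ∈ Cstar := by
    rw [hCstar]
    exact ⟨hd₀, hE.refl d₀⟩
  obtain ⟨p, hp⟩ := htwoway d₀.snd v
  obtain ⟨e, he, ⟨c, hc, hcu⟩, hout⟩ := p.exists_boundary_dart {u | ∃ d ∈ Cstar, d.snd = u}
    ⟨d₀, hd₀star, rfl⟩ (fun ⟨d, hd, hdv⟩ => hv d hd hdv)
  obtain ⟨heH, hsymmH⟩ := hp e he
  -- `f` is the dart of `H` preceding `e`; it enters the boundary vertex `e.fst`, as does `e.symm`.
  obtain ⟨f, hf⟩ := hπ.exists_rhPred e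
  have hfe : CycEq G π f e := .inl (.single hf)
  have hfH : f ∈ H := hπ.mem_of_cycEq hclosed (hE.symm hfe) heH
  have hfstar : f ∉ Cstar := fun h => hout ⟨e, hstar h hfe, rfl⟩
  have hsymmstar : e.symm ∉ Cstar := fun h => by
    obtain ⟨g, hg⟩ := hπ.exists_rhPred e.symm
    exact hout ⟨g, hstar h (.inr (.single hg)), hg.1.symm⟩
  have hfsymm : CycEq G π f e.symm := by
    by_contra hne
    exact hMerge3 e.fst ⟨c, hc, hcu⟩ ⟨c, f, e.symm, hstarH hc, hfH, hsymmH, hcu, hf.1.symm, rfl,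
      fun h => hfstar (hstar hc h), fun h => hsymmstar (hstar hc h), hne⟩
  have hfeq : f = e.symm := by
    by_contra hne
    exact hEatSmall e.fst ⟨c, hc, hcu⟩ ⟨f, e.symm, hfH, hsymmH, hfstar, hne, hfsymm,
      hf.1.symm, rfl⟩
  have hback : RHSucc G π e.symm e.symm.symm := by
    rw [SimpleGraph.Dart.symm_symm, ← hfeq]
    exact hf
  have hcfst : c.fst = e.snd :=
    hπ.eq_fst_of_rhSucc_symm hback (show G.Adj e.fst c.fst from hcu ▸ c.adj.symm)
  have hce : c = e.symm := SimpleGraph.Dart.ext _ _ (Prod.ext hcfst hcu)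
  exact hsymmstar (hce ▸ hc)
end
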